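/- arXiv:0803.4281 — 2 statements merged into one kernel-verified Lean document; each statement's English description precedes it below -/
import Mathlib

section
/- Let n ≥ 6, let Q be any group admitting a surjective group homomorphism π : Aut(F_n) → Q (for example Q = Out(F_n), the quotient of Aut(F_n) by its inner automorphisms), and let ρ be a C¹ action of Q on the circle. Then ρ factors through an action of ℤ/2ℤ: the kernel of ρ is a subgroup of Q of index at most 2. -/
open MeasureTheory

/-- The group of self-homeomorphisms of the circle `S¹ = ℝ/ℤ`,
with `f * g = f ∘ g`. -/
noncomputable instance : Group (UnitAddCircle ≃ₜ UnitAddCircle) where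
  mul f g := g.trans f
  one := Homeomorph.refl _
  inv := Homeomorph.symm
  mul_assoc _ _ _ := Homeomorph.ext fun _ => rfl
  one_mul _ := Homeomorph.ext fun _ => rfl
  mul_one _ := Homeomorph.ext fun _ => rfl
  inv_mul_cancel a := Homeomorph.ext a.symm_apply_apply

/-- `F : ℝ → ℝ` is a `C¹` lift of the circle homeomorphism `f`: it is `C¹` with
nowhere-vanishing derivative, commutes with the deck transformation up to sign,
and descends to `f` on `ℝ/ℤ`. -/
def IsC1Lift (f : UnitAddCircle ≃ₜ UnitAddCircle) (F : ℝ → ℝ) : Prop :=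
  ContDiff ℝ 1 F ∧ (∀ x : ℝ, deriv F x ≠ 0) ∧
    ((∀ x : ℝ, F (x + 1) = F x + 1) ∨ (∀ x : ℝ, F (x + 1) = F x - 1)) ∧
    ∀ x : ℝ, f (x : UnitAddCircle) = ((F x : ℝ) : UnitAddCircle)

/-- A `C¹` action of a group `Γ` on the circle: a homomorphism into the
self-homeomorphisms of the circle all of whose values admit `C¹` lifts. -/
def IsC1Action {Γ : Type*} [Group Γ] (ρ : Γ →* (UnitAddCircle ≃ₜ UnitAddCircle)) : Prop :=
  ∀ γ : Γ, ∃ F : ℝ → ℝ, IsC1Lift (ρ γ) F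

/-- `F : ℝ → ℝ` is an orientation-preserving `C¹` lift of the circle
homeomorphism `f`: it is `C¹` with everywhere positive derivative,
satisfies `F (x+1) = F x + 1` and descends to `f` on `ℝ/ℤ`. -/
def IsOPC1Lift (f : UnitAddCircle ≃ₜ UnitAddCircle) (F : ℝ → ℝ) : Prop :=
  ContDiff ℝ 1 F ∧ (∀ x : ℝ, 0 < deriv F x) ∧
    (∀ x : ℝ, F (x + 1) = F x + 1) ∧
    ∀ x : ℝ, f (x : UnitAddCircle) = ((F x : ℝ) : UnitAddCircle)

/-- `F : ℝ → ℝ` is an orientation-preserving (topological) lift of the circle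
homeomorphism `f`: continuous, strictly increasing, satisfies
`F (x+1) = F x + 1`, and descends to `f` on `ℝ/ℤ`. -/
def IsOPLift (f : UnitAddCircle ≃ₜ UnitAddCircle) (F : ℝ → ℝ) : Prop :=
  Continuous F ∧ StrictMono F ∧
    (∀ x : ℝ, F (x + 1) = F x + 1) ∧
    ∀ x : ℝ, f (x : UnitAddCircle) = ((F x : ℝ) : UnitAddCircle)

namespace FreeGroup

variable {α : Type*} [DecidableEq α]

/-- The length of the longest common prefix of two words. -/
def prefixLength : List (α × Bool) → List (α × Bool) → ℕ
  | a :: l, b :: m => if a = b then prefixLength l m + 1 else 0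
  | _, _ => 0

theorem le_prefixLength_iff (L M : List (α × Bool)) (k : ℕ) :
    k ≤ prefixLength L M ↔ k ≤ L.length ∧ k ≤ M.length ∧ L.take k = M.take k := by
  induction L generalizing M k with
  | nil => cases k <;> simp [prefixLength]
  | cons a L ih =>
    cases M with
    | nil => cases k <;> simp [prefixLength]
    | cons b M =>
      cases k with
      | zero => simp
      | succ k =>
        by_cases h : a = b
        · simp [prefixLength, h, ih]
        · simp [prefixLength, h]

theorem prefixLength_comm (L M : List (α × Bool)) : prefixLength L M = prefixLength M L :=
  eq_of_forall_le_iff fun k => by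
    simp only [le_prefixLength_iff, eq_comm (a := L.take k)]
    tauto

theorem isReduced_invRev {L : List (α × Bool)} (h : IsReduced L) : IsReduced (invRev L) := by
  rw [isReduced_iff_reduce_eq, reduce_invRev, h.reduce_eq]

theorem length_reduce_invRev_append {L M : List (α × Bool)} (hL : IsReduced L)
    (hM : IsReduced M) :
    (reduce (invRev L ++ M)).length + 2 * prefixLength L M = L.length + M.length := by
  induction L generalizing M with
  | nil => simp [prefixLength, hM.reduce_eq]
  | cons a L ih =>
    cases M with
    | nil => simp [prefixLength, (isReduced_invRev hL).reduce_eq]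
    | cons b M =>
      by_cases h : a = b
      · subst h
        have e : reduce (invRev (a :: L) ++ a :: M) = reduce (invRev L ++ M) := by
          apply reduce.Step.eq
          rw [invRev_cons]
          simpa [invRev] using Red.Step.not_rev (L₁ := invRev L) (L₂ := M) (x := a.1) (b := a.2)
        have := ih (M := M) hL.tail hM.tail
        simp only [e, prefixLength, if_true, List.length_cons]
        omega
      · have e : IsReduced (invRev (a :: L) ++ b :: M) := by
          rw [IsReduced, List.isChain_append]
          refine ⟨isReduced_invRev hL, hM, ?_⟩
          rw [invRev_cons]
          simp only [invRev, List.map_cons, List.map_nil, List.reverse_cons, List.reverse_nil,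
            List.nil_append, List.getLast?_append, List.getLast?_singleton, Option.some_or,
            Option.mem_def, Option.some.injEq, List.head?_cons, forall_eq']
          intro h1
          by_contra h2
          exact h (Prod.ext h1 (by revert h2; cases a.2 <;> cases b.2 <;> simp))
        rw [e.reduce_eq]
        simp [prefixLength, h]

/-- The length of the longest common prefix of the reduced words of `u` and `v`. -/
def overlap (u v : FreeGroup α) : ℕ := prefixLength u.toWord v.toWord

theorem overlap_comm (u v : FreeGroup α) : overlap u v = overlap v u := prefixLength_comm _ _

theorem norm_inv_mul_add (u v : FreeGroup α) :
    norm (u⁻¹ * v) + 2 * overlap u v = norm u + norm v := by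
  rw [norm, toWord_mul, toWord_inv]
  exact length_reduce_invRev_append isReduced_toWord isReduced_toWord

theorem norm_mul_add (u v : FreeGroup α) :
    norm (u * v) + 2 * overlap u⁻¹ v = norm u + norm v := by
  simpa using norm_inv_mul_add u⁻¹ v

theorem le_overlap_iff (u v : FreeGroup α) (k : ℕ) :
    k ≤ overlap u v ↔ k ≤ norm u ∧ k ≤ norm v ∧ u.toWord.take k = v.toWord.take k :=
  le_prefixLength_iff _ _ _

theorem min_overlap_le (u v w : FreeGroup α) : min (overlap u v) (overlap v w) ≤ overlap u w := by
  obtain ⟨h1, -, h3⟩ := (le_overlap_iff u v _).1 (min_le_left (overlap u v) (overlap v w))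
  obtain ⟨-, h5, h6⟩ := (le_overlap_iff v w _).1 (min_le_right (overlap u v) (overlap v w))
  exact (le_overlap_iff u w _).2 ⟨h1, h5, h3.trans h6⟩

theorem overlap_eq_of_lt {u v w : FreeGroup α} (h : overlap v w < overlap u v) :
    overlap u w = overlap v w := by
  have h1 := min_overlap_le u v w
  have h2 := min_overlap_le v u w
  rw [overlap_comm v u] at h2
  omega

/-- A word of length `2 * m` is determined by its first half and that of its inverse. -/
theorem toWord_eq_take_append {v : FreeGroup α} {m : ℕ} (h : norm v = 2 * m) :
    v.toWord = v.toWord.take m ++ invRev (v⁻¹.toWord.take m) := by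
  conv_lhs => rw [← List.take_append_drop m v.toWord]
  congr 1
  apply invRev_injective
  have h' : v.toWord.length = 2 * m := h
  rw [invRev_invRev, toWord_inv]
  simp only [invRev]
  rw [List.take_reverse, List.length_map, List.map_drop, h']
  congr 3
  omega

theorem two_mul_overlap_inv_self_lt {u : FreeGroup α} (hu : u ≠ 1) :
    2 * overlap u⁻¹ u < norm u := by
  by_contra! h
  obtain ⟨m, hm | hm⟩ := Nat.even_or_odd' (norm u)
  · have h1 := ((le_overlap_iff u⁻¹ u m).1 (by omega)).2.2
    have h2 := toWord_eq_take_append hm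
    rw [h1] at h2
    apply hu
    rw [← mk_toWord (x := u), h2, ← mul_mk, ← inv_mk, mul_inv_cancel]
  · have h1 := ((le_overlap_iff u⁻¹ u (m + 1)).1 (by omega)).2.2
    have hl : u.toWord.length = 2 * m + 1 := hm
    have h2 := congrArg (fun l => l[m]?) h1
    simp only [List.getElem?_take, toWord_inv, invRev, Nat.lt_succ_self, if_true] at h2
    rw [List.getElem?_reverse (by simp; omega), List.length_map, hl,
      show 2 * m + 1 - 1 - m = m by omega, List.getElem?_map,
      List.getElem?_eq_getElem (by omega)] at h2
    have h3 := congrArg Prod.snd (Option.some.inj h2)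
    simp at h3

/-- A homomorphism of free groups whose values on letters cancel less than completely in every
triple product does not decrease the length. -/
theorem norm_le_norm_map {β : Type*} [DecidableEq β] (ψ : FreeGroup β →* FreeGroup α)
    (h : ∀ x y z : β × Bool, (y.1, !y.2) ≠ x → (y.1, !y.2) ≠ z →
      overlap (ψ (mk [x]))⁻¹ (ψ (mk [y])) + overlap (ψ (mk [y]))⁻¹ (ψ (mk [z])) <
        norm (ψ (mk [y]))) (g : FreeGroup β) : norm g ≤ norm (ψ g) := by
  have key : ∀ (w : List (β × Bool)) (y : β × Bool), IsReduced (w ++ [y]) →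
      ∀ z, (y.1, !y.2) ≠ z →
        overlap (ψ (mk (w ++ [y])))⁻¹ (ψ (mk [z])) = overlap (ψ (mk [y]))⁻¹ (ψ (mk [z])) ∧
        w.length + 1 + overlap (ψ (mk [y]))⁻¹ (ψ (mk [z])) ≤ norm (ψ (mk (w ++ [y]))) := by
    intro w
    induction w using List.reverseRecOn with
    | nil =>
      intro y _ z hz
      have := h y y z (fun e => by simpa using congrArg Prod.snd e) hz
      exact ⟨rfl, by simp only [List.nil_append, List.length_nil]; omega⟩
    | append_singleton w x ih =>
      intro y hy z hz
      have hxy : (x.1, !x.2) ≠ y := by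
        rintro rfl
        have : IsReduced [x, (x.1, !x.2)] :=
          (List.append_assoc w [x] [(x.1, !x.2)] ▸ hy).right_of_append
        rw [isReduced_cons_cons] at this
        simpa using this.1
      obtain ⟨h1, h2⟩ := ih x hy.left_of_append y hxy
      have h3 := h x y z (by rintro rfl; simp at hxy) hz
      set P := ψ (mk (w ++ [x]))
      set u := ψ (mk [y])
      have e : ψ (mk (w ++ [x] ++ [y])) = P * u := by rw [← mul_mk, _root_.map_mul]
      rw [e]
      have h4 := norm_mul_add P u
      have h5 := norm_inv_mul_add (P * u)⁻¹ u⁻¹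
      rw [inv_inv, mul_inv_cancel_right, norm_inv_eq, norm_inv_eq] at h5
      refine ⟨overlap_eq_of_lt ?_, ?_⟩
      · omega
      · simp only [List.length_append, List.length_singleton]
        omega
  have hg := isReduced_toWord (x := g)
  rw [← mk_toWord (x := g)]
  rw [norm, toWord_mk, reduce_toWord]
  rcases List.eq_nil_or_concat g.toWord with e | ⟨w, y, e⟩
  · simp [e]
  · rw [List.concat_eq_append] at e
    rw [e] at hg ⊢
    have := (key w y hg y fun e => by simpa using congrArg Prod.snd e).2
    simp only [List.length_append, List.length_singleton]
    omega

section Cost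

variable [Fintype α]

/-- Words in the letters of `α`, read as numbers with the first letter the most significant. -/
noncomputable def wordCode (l : List (α × Bool)) : ℕ :=
  Nat.ofDigits (Fintype.card (α × Bool) + 2)
    (l.map fun a => (Fintype.equivFin (α × Bool) a : ℕ)).reverse

omit [DecidableEq α] in
theorem wordCode_append (p t : List (α × Bool)) :
    wordCode (p ++ t) =
      wordCode t + (Fintype.card (α × Bool) + 2) ^ t.length * wordCode p := by
  simp [wordCode, Nat.ofDigits_append]

omit [DecidableEq α] in
theorem wordCode_inj {p q : List (α × Bool)} (hl : p.length = q.length)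
    (h : wordCode p = wordCode q) : p = q := by
  have hd : ∀ l : List (α × Bool), ∀ d ∈
      (l.map fun a => (Fintype.equivFin (α × Bool) a : ℕ)).reverse,
      d < Fintype.card (α × Bool) + 2 := by
    intro l d hd
    simp only [List.mem_reverse, List.mem_map] at hd
    obtain ⟨a, -, rfl⟩ := hd
    have := (Fintype.equivFin (α × Bool) a).isLt
    omega
  have := Nat.ofDigits_inj_of_len_eq (by omega) (by simpa using hl) (hd p) (hd q) h
  refine List.map_injective_iff.2 (fun a b hab => ?_) (List.reverse_injective this)
  exact (Fintype.equivFin (α × Bool)).injective (Fin.ext hab)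

/-- The sum of the codes of the initial halves of `u` and of `u⁻¹`. -/
noncomputable def halfCode (u : FreeGroup α) : ℕ :=
  wordCode (u.toWord.take (norm u / 2)) + wordCode (u⁻¹.toWord.take (norm u / 2))

/-- The quantity minimised by Nielsen reduction: the length, with ties broken by `halfCode`. -/
noncomputable def nielsenCost (u : FreeGroup α) : ℕ ×ₗ ℕ := toLex (norm u, halfCode u)

theorem nielsenCost_inv (u : FreeGroup α) : nielsenCost u⁻¹ = nielsenCost u := by
  simp [nielsenCost, halfCode, add_comm]

theorem norm_le_of_nielsenCost_le {u v : FreeGroup α} (h : nielsenCost u ≤ nielsenCost v) :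
    norm u ≤ norm v := by
  rcases Prod.Lex.toLex_le_toLex.1 h with h | h
  · exact le_of_lt h
  · exact le_of_eq h.1

theorem nielsenCost_inv_mul_lt {v A : FreeGroup α} (hv : 2 * overlap A v = norm v)
    (hA : 2 * overlap A v ≤ norm A)
    (hc : wordCode (v⁻¹.toWord.take (overlap A v)) < wordCode (v.toWord.take (overlap A v))) :
    nielsenCost (v⁻¹ * A) < nielsenCost A := by
  have hnorm : norm (v⁻¹ * A) = norm A := by
    have := norm_inv_mul_add v A
    rw [overlap_comm v A] at this
    omega
  refine Prod.Lex.toLex_lt_toLex.2 (Or.inr ⟨hnorm, ?_⟩)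
  obtain ⟨h1, h2, h3⟩ := (le_overlap_iff A v _).1 le_rfl
  have hvw := toWord_eq_take_append hv.symm
  set m := overlap A v
  set p := v.toWord.take m
  set q := v⁻¹.toWord.take m
  have hp : p.length = m := by
    rw [List.length_take]
    exact min_eq_left h2
  have hq : q.length = m := by
    rw [List.length_take]
    refine min_eq_left (h2.trans_eq ?_)
    rw [← norm_inv_eq, norm]
  have hAw : A.toWord = p ++ A.toWord.drop m := by
    rw [← h3, List.take_append_drop]
  set s := A.toWord.drop m
  have hs : m + s.length = norm A := by
    rw [norm, hAw, List.length_append, hp]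
  have e : v⁻¹ * A = mk (q ++ s) := by
    rw [← mk_toWord (x := v), ← mk_toWord (x := A), hvw, hAw, ← mul_mk, ← mul_mk, ← mul_mk,
      ← inv_mk]
    group
  have hw : (v⁻¹ * A).toWord = q ++ s := by
    rw [e, toWord_mk]
    refine (reduce.red (L := q ++ s)).sublist.eq_of_length ?_
    have : (reduce (q ++ s)).length = norm (v⁻¹ * A) := by rw [e, norm, toWord_mk]
    rw [this, hnorm, List.length_append, hq, hs]
  have hinv : ∀ (r : List (α × Bool)) (k : ℕ), k ≤ s.length →
      (invRev (r ++ s)).take k = (invRev s).take k := by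
    intro r k hk
    rw [invRev_append, List.take_append_of_le_length (by simpa using hk)]
  unfold halfCode
  rw [hnorm, toWord_inv, toWord_inv, hw, hAw, hinv _ _ (by omega), hinv _ _ (by omega),
    add_lt_add_iff_right, List.take_append, List.take_append, hp, hq,
    List.take_of_length_le (l := q) (by omega), List.take_of_length_le (l := p) (by omega),
    wordCode_append,
    wordCode_append, add_lt_add_iff_left]
  exact Nat.mul_lt_mul_of_pos_left hc (by positivity)

/-- Nielsen-minimal injective homomorphisms do not decrease the length. -/
theorem norm_le_norm_of_nielsenCost_le {β : Type*} [DecidableEq β]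
    (ψ : FreeGroup β →* FreeGroup α) (hψ : Function.Injective ψ)
    (h : ∀ y z : β × Bool, y.1 ≠ z.1 →
      nielsenCost (ψ (mk [y])) ≤ nielsenCost (ψ (mk [z]) * ψ (mk [y])))
    (g : FreeGroup β) : norm g ≤ norm (ψ g) := by
  have hbar : ∀ y : β × Bool, (ψ (mk [y]))⁻¹ = ψ (mk [(y.1, !y.2)]) := by
    intro y
    rw [← _root_.map_inv, inv_mk]
    rfl
  have hne : ∀ y : β × Bool, ψ (mk [y]) ≠ 1 := by
    intro y
    rw [Ne, map_eq_one_iff ψ hψ, ← toWord_eq_nil_iff]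
    simp
  have heq : ∀ x y : β × Bool, (y.1, !y.2) ≠ x → x.1 = y.1 → x = y := by
    rintro ⟨i, a⟩ ⟨j, b⟩ h1 rfl
    cases a <;> cases b <;> simp_all
  have hN : ∀ x y : β × Bool, (y.1, !y.2) ≠ x →
      2 * overlap (ψ (mk [x]))⁻¹ (ψ (mk [y])) ≤ norm (ψ (mk [x])) ∧
      2 * overlap (ψ (mk [x]))⁻¹ (ψ (mk [y])) ≤ norm (ψ (mk [y])) ∧
      (x = y → 2 * overlap (ψ (mk [x]))⁻¹ (ψ (mk [y])) < norm (ψ (mk [y]))) := by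
    intro x y hxy
    by_cases e : x = y
    · subst e
      have := two_mul_overlap_inv_self_lt (hne x)
      exact ⟨this.le, this.le, fun _ => this⟩
    · have e' : x.1 ≠ y.1 := fun e' => e (heq x y hxy e')
      have h0 := norm_mul_add (ψ (mk [x])) (ψ (mk [y]))
      have h1 := norm_le_of_nielsenCost_le (h y x e'.symm)
      have h2 := norm_le_of_nielsenCost_le (h (x.1, !x.2) (y.1, !y.2) e')
      rw [← hbar, ← hbar, ← mul_inv_rev, norm_inv_eq, norm_inv_eq] at h2
      exact ⟨by omega, by omega, fun h => absurd h e⟩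
  refine norm_le_norm_map ψ (fun x y z hx hz => ?_) g
  have hz' : (z.1, !z.2) ≠ y := by
    rintro rfl
    simp at hz
  obtain ⟨a1, a2, a3⟩ := hN x y hx
  obtain ⟨b1, b2, b3⟩ := hN y z hz'
  by_contra! hlt
  have hxy : x.1 ≠ y.1 := fun e => by
    have := a3 (heq x y hx e)
    omega
  have hyz : z.1 ≠ y.1 := fun e => by
    have e' := heq z y hz e
    have := b3 e'.symm
    rw [e'] at this hlt
    omega
  have hm : overlap (ψ (mk [z])) (ψ (mk [y]))⁻¹ = overlap (ψ (mk [x]))⁻¹ (ψ (mk [y])) := by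
    rw [overlap_comm (ψ (mk [z]))]
    omega
  set v := ψ (mk [y])
  set m := overlap (ψ (mk [x]))⁻¹ v with hmdef
  rcases lt_trichotomy (wordCode (v⁻¹.toWord.take m)) (wordCode (v.toWord.take m)) with hc | hc | hc
  · refine (nielsenCost_inv_mul_lt (v := v) (A := (ψ (mk [x]))⁻¹) (by omega)
      (by rw [norm_inv_eq]; omega) hc).not_ge ?_
    rw [hbar, hbar]
    exact h (x.1, !x.2) (y.1, !y.2) hxy
  · have hv : norm v = 2 * m := by omega
    have hv' : v.toWord.length = 2 * m := hv
    have e := wordCode_inj (by simp) hc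
    have : 2 * overlap v⁻¹ v < norm v := two_mul_overlap_inv_self_lt (hne y)
    have h4 : m ≤ overlap v⁻¹ v :=
      (le_overlap_iff _ _ _).2 ⟨by rw [norm_inv_eq]; omega, by omega, e⟩
    omega
  · refine (nielsenCost_inv_mul_lt (v := v⁻¹) (A := ψ (mk [z]))
      (by rw [norm_inv_eq]; omega) (by omega) (by rwa [hm, inv_inv])).not_ge ?_
    rw [inv_inv]
    exact h z y hyz

end Cost

section Nielsen

omit [DecidableEq α] in
theorem mulAut_ext {φ ψ : MulAut (FreeGroup α)} (h : ∀ k, φ (of k) = ψ (of k)) : φ = ψ :=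
  MulEquiv.toMonoidHom_injective (ext_hom _ _ h)

/-- The endomorphism fixing all generators except `x i`, which is sent to
`x j ^ a * x i * x j ^ b`. -/
def transvectionHom (i j : α) (a b : ℤ) : FreeGroup α →* FreeGroup α :=
  lift fun k => if k = i then of j ^ a * of i * of j ^ b else of k

theorem transvectionHom_comp {i j : α} (h : i ≠ j) (a b c d : ℤ) :
    (transvectionHom i j a b).comp (transvectionHom i j c d) =
      transvectionHom i j (c + a) (b + d) := by
  refine ext_hom _ _ fun k => ?_
  by_cases hk : k = i
  · simp [transvectionHom, hk, h.symm, zpow_add, mul_assoc]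
  · simp [transvectionHom, hk]

theorem transvectionHom_zero (i j : α) : transvectionHom i j 0 0 = MonoidHom.id _ := by
  refine ext_hom _ _ fun k => ?_
  by_cases hk : k = i <;> simp [transvectionHom, hk]

/-- The automorphism fixing all generators except `x i`, which is sent to
`x j ^ a * x i * x j ^ b`. -/
def transvection {i j : α} (h : i ≠ j) (a b : ℤ) : MulAut (FreeGroup α) :=
  MonoidHom.toMulEquiv (transvectionHom i j a b) (transvectionHom i j (-a) (-b))
    (by rw [transvectionHom_comp h]; simp [transvectionHom_zero])
    (by rw [transvectionHom_comp h]; simp [transvectionHom_zero])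

theorem transvection_apply_of {i j : α} (h : i ≠ j) (a b : ℤ) (k : α) :
    transvection h a b (of k) = if k = i then of j ^ a * of i * of j ^ b else of k :=
  lift_apply_of

theorem transvection_inv {i j : α} (h : i ≠ j) (a b : ℤ) :
    (transvection h a b)⁻¹ = transvection h (-a) (-b) :=
  MulEquiv.ext fun _ => rfl

/-- The endomorphism inverting the generator `x i` and fixing the others. -/
def inversionHom (i : α) : FreeGroup α →* FreeGroup α :=
  lift fun k => if k = i then (of i)⁻¹ else of k

theorem inversionHom_comp_self (i : α) :
    (inversionHom i).comp (inversionHom i) = MonoidHom.id _ := by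
  refine ext_hom _ _ fun k => ?_
  by_cases hk : k = i <;> simp [inversionHom, hk]

/-- The automorphism inverting the generator `x i` and fixing the others. -/
def inversion (i : α) : MulAut (FreeGroup α) :=
  MonoidHom.toMulEquiv (inversionHom i) (inversionHom i) (inversionHom_comp_self i)
    (inversionHom_comp_self i)

theorem inversion_apply_of (i k : α) :
    inversion i (of k) = if k = i then (of i)⁻¹ else of k :=
  lift_apply_of

/-- **Nielsen's theorem**: transvections, inversions and transpositions of the generators generate
the automorphism group of a free group of finite rank. -/
theorem eq_top_of_nielsen_mem [Fintype α] (H : Subgroup (MulAut (FreeGroup α)))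
    (hl : ∀ (i j : α) (h : i ≠ j), transvection h 1 0 ∈ H)
    (hr : ∀ (i j : α) (h : i ≠ j), transvection h 0 1 ∈ H)
    (hinv : ∀ i, inversion i ∈ H)
    (hswap : ∀ i j : α, i ≠ j → freeGroupCongr (Equiv.swap i j) ∈ H) : H = ⊤ := by
  have hperm : ∀ σ : Equiv.Perm α, (freeGroupCongr σ : MulAut (FreeGroup α)) ∈ H := by
    intro σ
    induction σ using Equiv.Perm.swap_induction_on with
    | one =>
      convert H.one_mem
      exact mulAut_ext fun k => by simp
    | swap_mul f x y hxy ih =>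
      convert H.mul_mem (hswap x y hxy) ih
      exact mulAut_ext fun k => by simp
  have hsign : ∀ S : Finset α, ∃ e ∈ H, ∀ k, e (of k) = if k ∈ S then (of k)⁻¹ else of k := by
    intro S
    induction S using Finset.induction_on with
    | empty => exact ⟨1, H.one_mem, by simp⟩
    | insert a S ha ih =>
      obtain ⟨e, he, he'⟩ := ih
      refine ⟨inversion a * e, H.mul_mem (hinv a) he, fun k => ?_⟩
      rw [MulAut.mul_apply, he']
      by_cases hk : k = a
      · subst hk
        simp [ha, inversion_apply_of]
      · by_cases hS : k ∈ S <;> simp [hk, hS, inversion_apply_of]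
  have hl' : ∀ (i j : α) (h : i ≠ j), transvection h (-1) 0 ∈ H := fun i j h => by
    simpa [transvection_inv] using H.inv_mem (hl i j h)
  have hr' : ∀ (i j : α) (h : i ≠ j), transvection h 0 (-1) ∈ H := fun i j h => by
    simpa [transvection_inv] using H.inv_mem (hr i j h)
  rw [eq_top_iff]
  intro φ _
  obtain ⟨τ, hτ, hmin⟩ := exists_minimalFor_of_wellFoundedLT (fun e => e ∈ H)
    (fun e => ∑ i, nielsenCost ((φ * e) (of i))) ⟨1, H.one_mem⟩
  set ψ := φ * τ with hψ
  have hmin' : ∀ i j (h : i ≠ j) a b, transvection h a b ∈ H →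
      nielsenCost (ψ (of i)) ≤ nielsenCost (ψ (of j) ^ a * ψ (of i) * ψ (of j) ^ b) := by
    intro i j h a b hab
    have h1 := (le_total _ _).elim id (hmin (H.mul_mem hτ hab))
    simp only [← mul_assoc, ← hψ] at h1
    rw [← Finset.add_sum_erase _ _ (Finset.mem_univ i),
      ← Finset.add_sum_erase _ _ (Finset.mem_univ i)] at h1
    have h2 : ∑ k ∈ Finset.univ.erase i, nielsenCost ((ψ * transvection h a b) (of k)) =
        ∑ k ∈ Finset.univ.erase i, nielsenCost (ψ (of k)) := by
      refine Finset.sum_congr rfl fun k hk => ?_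
      rw [MulAut.mul_apply, transvection_apply_of, if_neg (Finset.ne_of_mem_erase hk)]
    rw [h2] at h1
    have h3 := le_of_add_le_add_right h1
    rwa [MulAut.mul_apply _ ψ, transvection_apply_of, if_pos rfl, _root_.map_mul, _root_.map_mul,
      map_zpow, map_zpow] at h3
  have hbar : ∀ i : α, (mk [(i, false)] : FreeGroup α) = (of i)⁻¹ := fun _ => rfl
  have hletter : ∀ i : α, (mk [(i, true)] : FreeGroup α) = of i := fun _ => rfl
  have hlen : ∀ g, norm g ≤ norm (ψ g) := by
    refine norm_le_norm_of_nielsenCost_le ψ.toMonoidHom ψ.injective ?_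
    rintro ⟨i, a⟩ ⟨j, b⟩ hij
    have hij : i ≠ j := hij
    have h1 := hmin' i j hij 1 0 (hl i j hij)
    have h2 := hmin' i j hij (-1) 0 (hl' i j hij)
    have h3 := hmin' i j hij 0 1 (hr i j hij)
    have h4 := hmin' i j hij 0 (-1) (hr' i j hij)
    simp only [zpow_one, zpow_zero, mul_one, one_mul, zpow_neg] at h1 h2 h3 h4
    rw [← nielsenCost_inv, ← nielsenCost_inv (_ * _), mul_inv_rev] at h3 h4
    rw [inv_inv] at h4
    cases a <;> cases b <;>
      simpa [hbar, hletter, MulEquiv.toMonoidHom_eq_coe]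
  have hex : ∀ i, ∃ a : α × Bool, ψ⁻¹ (of i) = mk [a] := by
    intro i
    have h1 := hlen (ψ⁻¹ (of i))
    rw [MulAut.apply_inv_self, norm_of] at h1
    have h2 : norm (ψ⁻¹ (of i)) ≠ 0 := by
      rw [Ne, norm_eq_zero, map_eq_one_iff _ (ψ⁻¹).injective]
      exact of_ne_one i
    obtain ⟨a, ha⟩ := List.length_eq_one_iff.1 (show (ψ⁻¹ (of i)).toWord.length = 1 by
      change norm _ = 1; omega)
    exact ⟨a, by rw [← ha, mk_toWord]⟩
  choose a ha using hex
  have hinj : Function.Injective fun i => (a i).1 := by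
    intro i j hij
    have h1 : ψ⁻¹ (of i) = ψ⁻¹ (of j) ∨ ψ⁻¹ (of i) = ψ⁻¹ (of j)⁻¹ := by
      rw [_root_.map_inv, ha, ha, inv_mk]
      have hij : (a i).1 = (a j).1 := hij
      rcases hi : a i with ⟨k, c⟩
      rcases hj : a j with ⟨l, d⟩
      rw [hi, hj] at hij
      obtain rfl : k = l := hij
      cases c <;> cases d <;> simp [invRev]
    rcases h1 with h1 | h1
    · exact of_injective ((ψ⁻¹).injective h1)
    · have h2 := congrArg toWord ((ψ⁻¹).injective h1)
      rw [toWord_inv, toWord_of, toWord_of] at h2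
      simp [invRev] at h2
  obtain ⟨e, he, he'⟩ := hsign (Finset.univ.filter fun i => (a i).2 = false)
  have hψe : ψ⁻¹ =
      freeGroupCongr (Equiv.ofBijective _ (Finite.injective_iff_bijective.1 hinj)) * e := by
    refine mulAut_ext fun k => ?_
    rw [MulAut.mul_apply, he', ha]
    rcases hk : a k with ⟨l, _ | _⟩
    · simp [hk, hbar]
    · simp [hk, hletter]
  have hmem : ψ⁻¹ ∈ H := hψe ▸ H.mul_mem (hperm _) he
  have : φ = ψ * τ⁻¹ := by rw [hψ, mul_inv_cancel_right]
  rw [this]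
  exact H.mul_mem (inv_mem_iff.1 hmem) (H.inv_mem hτ)

end Nielsen

section Rigidity

/-- The automorphism exchanging the generators `x i` and `x j`. -/
def transposition (i j : α) : MulAut (FreeGroup α) := freeGroupCongr (Equiv.swap i j)

theorem transposition_apply_of (i j k : α) :
    transposition i j (of k) = if k = i then of j else if k = j then of i else of k := by
  simp only [transposition, freeGroupCongr_apply, map.of, Equiv.swap_apply_def]
  split_ifs <;> rfl

theorem inversion_mul_self (i : α) : inversion i * inversion i = 1 :=
  mulAut_ext fun k => by by_cases h : k = i <;> simp [inversion_apply_of, h]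

theorem inversion_comm (i j : α) : inversion i * inversion j = inversion j * inversion i :=
  mulAut_ext fun k => by
    by_cases h : k = i <;> by_cases h' : k = j <;> simp_all [inversion_apply_of]

theorem transposition_mul_inversion {i j : α} :
    transposition i j * inversion i = inversion j * transposition i j :=
  mulAut_ext fun k => by
    by_cases h : k = i <;> by_cases h' : k = j <;> by_cases h'' : i = j <;>
      simp_all [inversion_apply_of, transposition_apply_of, eq_comm]

theorem transposition_mul_inversion_of_ne {i j k : α} (hi : k ≠ i) (hj : k ≠ j) :
    transposition i j * inversion k = inversion k * transposition i j :=
  mulAut_ext fun l => by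
    by_cases h : l = i <;> by_cases h' : l = j <;> by_cases h'' : l = k <;>
      simp_all [inversion_apply_of, transposition_apply_of, hi.symm, hj.symm]

theorem transposition_mul_transvection {i j k : α} (hij : i ≠ j) (hik : i ≠ k) (hjk : j ≠ k)
    (a b : ℤ) :
    transposition j k * transvection hij a b = transvection hik a b * transposition j k :=
  mulAut_ext fun l => by
    by_cases h : l = i <;> by_cases h' : l = j <;> by_cases h'' : l = k <;>
      simp_all [transvection_apply_of, transposition_apply_of, hij.symm, hik.symm, hjk.symm]

theorem inversion_mul_transvection_left {i j : α} (h : i ≠ j) :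
    inversion i * transvection h 1 0 = transvection h 0 (-1) * inversion i :=
  mulAut_ext fun l => by
    by_cases h' : l = i <;> simp_all [transvection_apply_of, inversion_apply_of, h.symm]

theorem inversion_mul_transvection_right {i j : α} (h : i ≠ j) (a b : ℤ) :
    inversion j * transvection h a b = transvection h (-a) (-b) * inversion j :=
  mulAut_ext fun l => by
    by_cases h' : l = i <;> by_cases h'' : l = j <;>
      simp_all [transvection_apply_of, inversion_apply_of, h.symm]

theorem inversion_mul_transvection_of_ne {i j k : α} (h : i ≠ j) (hi : k ≠ i) (hj : k ≠ j)
    (a b : ℤ) : inversion k * transvection h a b = transvection h a b * inversion k :=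
  mulAut_ext fun l => by
    by_cases h' : l = i <;> by_cases h'' : l = k <;>
      simp_all [transvection_apply_of, inversion_apply_of, hj.symm]

theorem transvection_left_comm_right {i j k : α} (hij : i ≠ j) (hik : i ≠ k) :
    transvection hij 1 0 * transvection hik 0 1 = transvection hik 0 1 * transvection hij 1 0 :=
  mulAut_ext fun l => by
    by_cases h' : l = i <;>
      simp_all [transvection_apply_of, hij.symm, hik.symm, mul_assoc]

theorem transvection_mul_transvection {i j k : α} (hij : i ≠ j) (hik : i ≠ k) (hjk : j ≠ k) :
    transvection hjk 1 0 * transvection hij 1 0 =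
      transvection hij 1 0 * transvection hik 1 0 * transvection hjk 1 0 :=
  mulAut_ext fun l => by
    by_cases h' : l = i <;> by_cases h'' : l = j <;>
      simp_all [transvection_apply_of, hij.symm, hik.symm, mul_assoc]

theorem transposition_eq {i j : α} (h : i ≠ j) :
    transposition i j = inversion i * transvection h 1 0 * (transvection h.symm 1 0)⁻¹ *
      transvection h 0 1 :=
  mulAut_ext fun l => by
    rw [transvection_inv]
    by_cases h' : l = i <;> by_cases h'' : l = j <;>
      simp_all [transvection_apply_of, transposition_apply_of, inversion_apply_of, h.symm]

variable {K : Type*} [Group K]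

theorem map_transvection_eq_one [Fintype α] (hα : 3 ≤ Fintype.card α)
    (f : MulAut (FreeGroup α) →* K) (s : MulAut (FreeGroup α) →* ℤˣ)
    (hf : ∀ a b, s a = 1 → s b = 1 → f a * f a = 1 → f b * f b = 1 → f a * f b = f b * f a →
      f a = 1 ∨ f b = 1 ∨ f a = f b) :
    (∀ i j, f (inversion i * inversion j) = 1) ∧
    (∀ i j (h : i ≠ j), f (transvection h 1 0) = 1) ∧
    (∀ i j (h : i ≠ j), f (transvection h 0 1) = 1) := by
  have hthird : ∀ i j : α, ∃ k, k ≠ i ∧ k ≠ j := by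
    intro i j
    obtain ⟨k, hk⟩ := Finset.exists_mem_notMem_of_card_lt_card (s := {i, j}) (t := Finset.univ)
      ((Finset.card_le_two).trans_lt (by rw [Finset.card_univ]; omega))
    exact ⟨k, by simpa using hk⟩
  have hconj : ∀ {c a b : MulAut (FreeGroup α)}, c * a = b * c → f a = 1 → f b = 1 := by
    intro c a b h ha
    have := congrArg f h
    rw [_root_.map_mul, _root_.map_mul, ha, mul_one] at this
    exact mul_eq_right.1 this.symm
  have hsinv : ∀ i j, s (inversion i) = s (inversion j) := by
    intro i j
    have := congrArg s (transposition_mul_inversion (i := i) (j := j))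
    rw [_root_.map_mul, _root_.map_mul, mul_comm] at this
    exact mul_right_cancel this
  have hsprod : ∀ i j, s (inversion i * inversion j) = 1 := by
    intro i j
    rw [_root_.map_mul, hsinv i j, Int.units_mul_self]
  have hu : ∀ i, f (inversion i) * f (inversion i) = 1 := by
    intro i
    rw [← _root_.map_mul, inversion_mul_self, _root_.map_one]
  have hucomm : ∀ i j, Commute (f (inversion i)) (f (inversion j)) := by
    intro i j
    change _ * _ = _ * _
    rw [← _root_.map_mul, inversion_comm, _root_.map_mul]
  have hA : ∀ i j, f (inversion i * inversion j) = 1 := by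
    intro i j
    by_cases hij : i = j
    · rw [hij, inversion_mul_self, _root_.map_one]
    obtain ⟨k, hki, hkj⟩ := hthird i j
    have hsq : ∀ i j, f (inversion i * inversion j) * f (inversion i * inversion j) = 1 := by
      intro i j
      rw [_root_.map_mul, (hucomm j i).mul_mul_mul_comm, hu, hu, one_mul]
    have hc : f (inversion i * inversion j) * f (inversion i * inversion k) =
        f (inversion i * inversion k) * f (inversion i * inversion j) := by
      rw [_root_.map_mul, _root_.map_mul]
      exact ((hucomm i i).mul_right (hucomm i k)).mul_left
        ((hucomm j i).mul_right (hucomm j k))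
    rcases hf _ _ (hsprod i j) (hsprod i k) (hsq i j) (hsq i k) hc with h | h | h
    · exact h
    · refine hconj (c := transposition k j) ?_ h
      rw [← mul_assoc, transposition_mul_inversion_of_ne (Ne.symm hki) hij, mul_assoc,
        transposition_mul_inversion, mul_assoc]
    · have h' : f (inversion k * inversion j) = 1 := by
        rw [_root_.map_mul, _root_.map_mul, mul_left_cancel_iff] at h
        rw [_root_.map_mul, h, hu]
      refine hconj (c := transposition k i) ?_ h'
      rw [← mul_assoc, transposition_mul_inversion, mul_assoc,
        transposition_mul_inversion_of_ne (Ne.symm hkj) (Ne.symm hij), mul_assoc]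
  have hueq : ∀ i j, f (inversion i) = f (inversion j) := by
    intro i j
    have := hA i j
    rw [_root_.map_mul, ← hu j] at this
    exact mul_right_cancel this
  have hneg : ∀ i j (h : i ≠ j),
      f (transvection h (-1) 0) = (f (transvection h 1 0))⁻¹ ∧
      f (transvection h 0 (-1)) = (f (transvection h 0 1))⁻¹ := by
    intro i j h
    simp [← _root_.map_inv, transvection_inv]
  have hLR : ∀ i j (h : i ≠ j), f (transvection h 1 0) * f (transvection h 1 0) = 1 ∧
      f (transvection h 0 1) = f (transvection h 1 0) := by
    intro i j h
    obtain ⟨k, hki, hkj⟩ := hthird i j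
    have h1 := congrArg f (inversion_mul_transvection_left h)
    have h2 := congrArg f (inversion_mul_transvection_right h 1 0)
    have h3 := congrArg f (inversion_mul_transvection_of_ne h hki hkj 1 0)
    rw [neg_zero] at h2
    rw [_root_.map_mul, _root_.map_mul, hueq i k, (hneg i j h).2] at h1
    rw [_root_.map_mul, _root_.map_mul, hueq j k, (hneg i j h).1] at h2
    rw [_root_.map_mul, _root_.map_mul] at h3
    have h4 := mul_right_cancel (h3.symm.trans h1)
    have h5 := mul_right_cancel (h3.symm.trans h2)
    refine ⟨mul_eq_one_iff_eq_inv.2 h5, ?_⟩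
    rw [h5, h4, inv_inv]
  have hL : ∀ i j (h : i ≠ j), f (transvection h 1 0) = 1 := by
    intro i j hij
    obtain ⟨k, hki, hkj⟩ := hthird i j
    have hsT : ∀ {i j k : α} (_ : i ≠ j) (hik : i ≠ k) (_ : j ≠ k),
        s (transvection hik 1 0) = 1 := by
      intro i j k hij hik hjk
      have := congrArg s (transvection_mul_transvection hij hik hjk)
      rw [_root_.map_mul, _root_.map_mul, _root_.map_mul, mul_comm, mul_right_cancel_iff] at this
      exact left_eq_mul.1 this
    have hc := congrArg f (transvection_left_comm_right hij hki.symm)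
    rw [_root_.map_mul, _root_.map_mul, (hLR i k hki.symm).2] at hc
    rcases hf _ _ (hsT hki.symm hij hkj) (hsT hij hki.symm hkj.symm) (hLR i j hij).1
      (hLR i k hki.symm).1 hc with h | h | h
    · exact h
    · exact hconj (transposition_mul_transvection hki.symm hij hkj 1 0) h
    · have := congrArg f (transvection_mul_transvection hij hki.symm hkj.symm)
      rw [_root_.map_mul, _root_.map_mul, _root_.map_mul, ← h, (hLR i j hij).1, one_mul] at this
      exact mul_eq_left.1 this
  exact ⟨hA, hL, fun i j h => by rw [(hLR i j h).2, hL]⟩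

/-- A homomorphism from `Aut (F_n)`, `n ≥ 3`, to a group in which any two commuting involutions in
the image of the kernel of some sign character coincide has image of order at most two. -/
theorem card_range_le_two [Fintype α] (hα : 3 ≤ Fintype.card α)
    (f : MulAut (FreeGroup α) →* K) (s : MulAut (FreeGroup α) →* ℤˣ)
    (hf : ∀ a b, s a = 1 → s b = 1 → f a * f a = 1 → f b * f b = 1 → f a * f b = f b * f a →
      f a = 1 ∨ f b = 1 ∨ f a = f b) :
    Nat.card f.range = 1 ∨ Nat.card f.range = 2 := by
  obtain ⟨hA, hL, hR⟩ := map_transvection_eq_one hα f s hf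
  obtain ⟨i₀⟩ : Nonempty α := Fintype.card_pos_iff.1 (by omega)
  set t := f (inversion i₀)
  have ht : t ^ 2 = 1 := by
    rw [sq, ← _root_.map_mul, inversion_mul_self, _root_.map_one]
  have hinv : ∀ i, f (inversion i) ∈ Subgroup.zpowers t := by
    intro i
    have := hA i i₀
    rw [_root_.map_mul, mul_eq_one_iff_eq_inv] at this
    rw [this]
    exact inv_mem (Subgroup.mem_zpowers t)
  have htop : (Subgroup.zpowers t).comap f = ⊤ := by
    refine eq_top_of_nielsen_mem _ (fun i j h => ?_) (fun i j h => ?_) hinv (fun i j h => ?_)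
    · rw [Subgroup.mem_comap, hL]
      exact one_mem _
    · rw [Subgroup.mem_comap, hR]
      exact one_mem _
    · rw [Subgroup.mem_comap, ← transposition, transposition_eq h]
      simpa [hL, hR] using hinv i
  have hrange : f.range = Subgroup.zpowers t := by
    refine le_antisymm ?_ ?_
    · rw [MonoidHom.range_eq_map, Subgroup.map_le_iff_le_comap, htop]
    · rw [Subgroup.zpowers_le]
      exact ⟨_, rfl⟩
  rw [hrange, Nat.card_zpowers]
  exact (Nat.dvd_prime Nat.prime_two).1 (orderOf_dvd_of_pow_eq_one ht)

end Rigidity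

end FreeGroup

section CircleLifts

/-- A continuous map `ℝ → ℝ` commuting up to the sign `d` with the deck transformation and
descending to the circle homeomorphism `f`. -/
def IsLift (f : UnitAddCircle ≃ₜ UnitAddCircle) (d : ℤˣ) (F : ℝ → ℝ) : Prop :=
  Continuous F ∧ (∀ x : ℝ, F (x + 1) = F x + (d : ℤ)) ∧
    ∀ x : ℝ, f (x : UnitAddCircle) = ((F x : ℝ) : UnitAddCircle)

theorem exists_int_forall_eq_add {F G : ℝ → ℝ} (hF : Continuous F) (hG : Continuous G)
    (h : ∀ x : ℝ, ((F x : ℝ) : UnitAddCircle) = (G x : ℝ)) : ∃ k : ℤ, ∀ x, F x = G x + k := by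
  have h1 : ∀ x, ∃ k : ℤ, F x - G x = k := by
    intro x
    have := h x
    rw [← sub_eq_zero, ← AddCircle.coe_sub, AddCircle.coe_eq_zero_iff] at this
    obtain ⟨k, hk⟩ := this
    exact ⟨k, by simpa using hk.symm⟩
  choose k hk using h1
  have hkc : Continuous k := by
    rw [Int.isClosedEmbedding_coe_real.isInducing.continuous_iff]
    exact (hF.sub hG).congr hk
  refine ⟨k 0, fun x => ?_⟩
  rw [← PreconnectedSpace.constant inferInstance hkc (x := x) (y := 0), ← hk]
  ring

theorem IsLift.apply_add_int {f : UnitAddCircle ≃ₜ UnitAddCircle} {d : ℤˣ} {F : ℝ → ℝ}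
    (h : IsLift f d F) (x : ℝ) (k : ℤ) : F (x + k) = F x + (d : ℤ) * k := by
  induction k using Int.induction_on with
  | zero => simp
  | succ n ih =>
    have := h.2.1 (x + n)
    push_cast at *
    rw [← add_assoc, this, ih]
    ring
  | pred n ih =>
    have := h.2.1 (x + (-n - 1))
    push_cast at *
    rw [show x + (-n - 1) + 1 = x + -(n : ℝ) by ring, ih] at this
    linarith

theorem IsLift.mul {f g : UnitAddCircle ≃ₜ UnitAddCircle} {d e : ℤˣ} {F G : ℝ → ℝ}
    (hf : IsLift f d F) (hg : IsLift g e G) : IsLift (f * g) (d * e) (F ∘ G) := by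
  refine ⟨hf.1.comp hg.1, fun x => ?_, fun x => ?_⟩
  · rw [Function.comp_apply, hg.2.1, hf.apply_add_int]
    push_cast
    rfl
  · change f (g x) = _
    rw [hg.2.2, hf.2.2]
    rfl

theorem IsLift.sign_unique {f : UnitAddCircle ≃ₜ UnitAddCircle} {d e : ℤˣ} {F G : ℝ → ℝ}
    (hF : IsLift f d F) (hG : IsLift f e G) : d = e := by
  obtain ⟨k, hk⟩ := exists_int_forall_eq_add hF.1 hG.1 fun x => by rw [← hF.2.2, ← hG.2.2]
  have h1 := hk (0 + 1)
  rw [hF.2.1, hG.2.1, hk 0] at h1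
  have : ((d : ℤ) : ℝ) = (e : ℤ) := by linarith
  exact Units.ext (by exact_mod_cast this)

theorem IsC1Lift.exists_isLift {f : UnitAddCircle ≃ₜ UnitAddCircle} {F : ℝ → ℝ}
    (h : IsC1Lift f F) : ∃ d : ℤˣ, IsLift f d F := by
  obtain ⟨h1, -, h3 | h3, h4⟩ := h
  · exact ⟨1, h1.continuous, by simpa using h3, h4⟩
  · exact ⟨-1, h1.continuous, by simpa [sub_eq_add_neg] using h3, h4⟩

theorem IsC1Lift.strictMono {f : UnitAddCircle ≃ₜ UnitAddCircle} {F : ℝ → ℝ}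
    (h : IsC1Lift f F) (hd : IsLift f 1 F) : StrictMono F := by
  have hc : Continuous (deriv F) := h.1.continuous_deriv le_rfl
  by_cases hpos : ∀ x, 0 < deriv F x
  · exact strictMono_of_deriv_pos hpos
  · exfalso
    push Not at hpos
    obtain ⟨x₀, hx₀⟩ := hpos
    have hneg : ∀ x, deriv F x < 0 := by
      intro x
      by_contra! hx
      obtain ⟨y, hy⟩ := mem_range_of_exists_le_of_exists_ge hc ⟨x₀, hx₀⟩ ⟨x, hx⟩
      exact h.2.1 y hy
    have h1 := strictAnti_of_deriv_neg hneg (show (0 : ℝ) < 0 + 1 by norm_num)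
    rw [hd.2.1] at h1
    norm_num at h1

/-- Every `C¹` action on the circle has an orientation character. -/
theorem IsC1Action.exists_orientation {Γ : Type*} [Group Γ]
    {ρ : Γ →* (UnitAddCircle ≃ₜ UnitAddCircle)} (hρ : IsC1Action ρ) :
    ∃ s : Γ →* ℤˣ, ∀ γ, s γ = 1 → ∃ F, IsLift (ρ γ) 1 F ∧ StrictMono F := by
  choose F hF using hρ
  choose s hs using fun γ => (hF γ).exists_isLift
  refine ⟨MonoidHom.mk' s fun a b => ?_, fun γ hγ => ⟨F γ, ?_⟩⟩
  · refine (hs (a * b)).sign_unique (G := F a ∘ F b) ?_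
    rw [map_mul]
    exact (hs a).mul (hs b)
  · have hγ : s γ = 1 := hγ
    have := hs γ
    rw [hγ] at this
    exact ⟨this, (hF γ).strictMono this⟩

theorem eq_one_or_exists_lift {f : UnitAddCircle ≃ₜ UnitAddCircle} {F : ℝ → ℝ}
    (hF : IsLift f 1 F) (hm : StrictMono F) (hf : f * f = 1) :
    f = 1 ∨ ∃ G, IsLift f 1 G ∧ StrictMono G ∧ ∀ x, G (G x) = x + 1 := by
  have hFF := hF.mul hF
  rw [hf] at hFF
  obtain ⟨k, hk⟩ := exists_int_forall_eq_add hFF.1 continuous_id fun x => by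
    rw [← hFF.2.2]; rfl
  have hsub : ∀ m : ℤ, IsLift f 1 fun x => F x - m := by
    intro m
    refine ⟨hF.1.sub continuous_const, fun x => ?_, fun x => ?_⟩
    · beta_reduce
      rw [hF.2.1]
      ring
    · rw [hF.2.2, AddCircle.coe_sub, eq_comm, sub_eq_self, AddCircle.coe_eq_zero_iff]
      exact ⟨m, by simp⟩
  have hmsub : ∀ m : ℤ, StrictMono fun x => F x - m := fun m a b hab => by
    simpa using hm hab
  have hsq : ∀ (m : ℤ) (x : ℝ), F (F x - m) - m = x + k - 2 * m := by
    intro m x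
    have h1 := hF.apply_add_int (F x) (-m)
    have h2 : F (F x) = x + k := hk x
    push_cast at h1
    rw [sub_eq_add_neg (F x), h1, h2]
    ring
  obtain ⟨m, rfl | rfl⟩ := Int.even_or_odd' k
  · left
    have hid : ∀ x, F x - m = x := by
      intro x
      have h1 := hsq m x
      push_cast at h1
      rcases lt_trichotomy (F x - m) x with h | h | h
      · have := hmsub m h
        simp only at this
        linarith
      · exact h
      · have := hmsub m h
        simp only at this
        linarith
    ext x
    induction x using QuotientAddGroup.induction_on with
    | H x =>
      have := (hsub m).2.2 x
      simp only [hid] at this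
      exact this
  · right
    refine ⟨_, hsub m, hmsub m, fun x => ?_⟩
    have h1 := hsq m x
    push_cast at h1
    rw [h1]
    ring

/-- Commuting orientation-preserving involutions of the circle coincide unless one is trivial. -/
theorem eq_of_commuting_involutions {f g : UnitAddCircle ≃ₜ UnitAddCircle} {F G : ℝ → ℝ}
    (hF : IsLift f 1 F) (hFm : StrictMono F) (hG : IsLift g 1 G) (hGm : StrictMono G)
    (hf : f * f = 1) (hg : g * g = 1) (hfg : f * g = g * f) : f = 1 ∨ g = 1 ∨ f = g := by
  rcases eq_one_or_exists_lift hF hFm hf with h | ⟨F', hF', hFm', hFF⟩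
  · exact Or.inl h
  rcases eq_one_or_exists_lift hG hGm hg with h | ⟨G', hG', hGm', hGG⟩
  · exact Or.inr (Or.inl h)
  right; right
  have hFG := hF'.mul hG'
  have hGF := hG'.mul hF'
  rw [← hfg] at hGF
  obtain ⟨m, hm⟩ := exists_int_forall_eq_add hFG.1 hGF.1 fun x => by
    rw [← hFG.2.2, ← hGF.2.2]
  simp only [Function.comp_apply] at hm
  have hm0 : (m : ℝ) = 0 := by
    have h1 : F' (F' (G' 0)) = G' 0 + 1 := hFF _
    have h2 : F' (G' (F' 0) + m) = F' (G' (F' 0)) + m := by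
      simpa using hF'.apply_add_int (G' (F' 0)) m
    have h3 : G' (0 + 1) = G' 0 + 1 := by simpa using hG'.2.1 0
    rw [hm 0, h2, hm, hFF, h3] at h1
    linarith
  have hcomm : ∀ x, F' (G' x) = G' (F' x) := fun x => by rw [hm, hm0, add_zero]
  have heq : ∀ x, F' x = G' x := by
    intro x
    rcases lt_trichotomy (F' x) (G' x) with h | h | h
    · have h1 := hFm' h
      have h2 := hGm' h
      rw [hFF, hcomm] at h1
      rw [hGG] at h2
      linarith
    · exact h
    · have h1 := hFm' h
      have h2 := hGm' h
      rw [hFF, hcomm] at h1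
      rw [hGG] at h2
      linarith
  ext x
  induction x using QuotientAddGroup.induction_on with
  | H x => exact (hF'.2.2 x).trans ((congrArg _ (heq x)).trans (hG'.2.2 x).symm)

end CircleLifts

/-- **Theorem.** For `n ≥ 6` and any quotient `Q` of `Aut(Fₙ)` (for instance
`Out(Fₙ)`), any `C¹` action of `Q` on the circle factors through an action of
`ℤ/2ℤ`: its kernel has index `1` or `2`. -/
theorem c1_action_of_quotient_of_autFreeGroup_factors_through_Z2
    {n : ℕ} (hn : 6 ≤ n)
    {Q : Type*} [Group Q]
    (π : MulAut (FreeGroup (Fin n)) →* Q) (hπ : Function.Surjective π)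
    (ρ : Q →* (UnitAddCircle ≃ₜ UnitAddCircle))
    (hρ : IsC1Action ρ) :
    (MonoidHom.ker ρ).index = 1 ∨ (MonoidHom.ker ρ).index = 2 := by
  obtain ⟨s, hs⟩ := hρ.exists_orientation
  have hrange : (ρ.comp π).range = ρ.range := by
    rw [MonoidHom.range_comp, MonoidHom.range_eq_top.2 hπ, ← MonoidHom.range_eq_map]
  rw [Subgroup.index_ker, ← hrange]
  refine FreeGroup.card_range_le_two (by rw [Fintype.card_fin]; omega) (ρ.comp π) (s.comp π)
    fun a b ha hb h1 h2 h3 => ?_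
  obtain ⟨F, hF, hFm⟩ := hs (π a) ha
  obtain ⟨G, hG, hGm⟩ := hs (π b) hb
  exact eq_of_commuting_involutions hF hFm hG hGm h1 h2 h3
end

section
/- Let n ≥ 6, let K be a finite-index subgroup of SL(n,ℤ) (the special linear group of n×n integer matrices of determinant 1), and let ρ be a C¹ action of K on the circle. Then ρ factors through an action of a finite group: the kernel of ρ has finite index in K. -/
open MeasureTheory

open scoped commutatorElement

/-! ### Heisenberg relations and left-ordered groups -/

theorem commutatorElement_zpow_zpow {G : Type*} [Group G] {x y z : G} (hxy : ⁅x, y⁆ = z)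
    (hxz : Commute x z) (hyz : Commute y z) (a b : ℤ) : ⁅x ^ a, y ^ b⁆ = z ^ (a * b) := by
  have key {x y z : G} (hxy : ⁅x, y⁆ = z) (hyz : Commute y z) (b : ℤ) : ⁅x, y ^ b⁆ = z ^ b := by
    have h : x * y * x⁻¹ = z * y := by rw [← hxy, commutatorElement_def]; group
    rw [commutatorElement_def, ← conj_zpow, h, hyz.symm.mul_zpow]
    group
  have h₁ : ⁅x, y ^ b⁆ = z ^ b := key hxy hyz b
  have h₂ : ⁅y ^ b, x⁆ = (z ^ b)⁻¹ := by rw [← h₁, commutatorElement_inv]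
  have h₃ := key h₂ (hxz.zpow_right b).inv_right a
  rw [← commutatorElement_inv, h₃, inv_zpow, inv_inv, ← zpow_mul, mul_comm b]

theorem mul_le_pow_add_of_commute {G : Type*} [Group G] [LinearOrder G] [MulLeftMono G]
    {Z g h : G} {a b : ℕ} (hg : g ≤ Z ^ a) (hh : h ≤ Z ^ b) (hc : Commute g Z) :
    g * h ≤ Z ^ (a + b) :=
  calc g * h ≤ g * Z ^ b := mul_le_mul_right hh g
    _ = Z ^ b * g := (hc.pow_right b).eq
    _ ≤ Z ^ b * Z ^ a := mul_le_mul_right hg _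
    _ = Z ^ (a + b) := by rw [← pow_add, add_comm]

theorem pow_le_pow_of_commute {G : Type*} [Group G] [LinearOrder G] [MulLeftMono G]
    {Z g : G} (hg : g ≤ Z) (hc : Commute g Z) (n : ℕ) : g ^ n ≤ Z ^ n := by
  induction n with
  | zero => simp
  | succ n ih =>
    rw [pow_succ]
    exact mul_le_pow_add_of_commute ih (by simpa using hg) (hc.pow_left n)

theorem commutatorElement_pow_le {G : Type*} [Group G] [LinearOrder G] [MulLeftMono G]
    {Z x y : G} (hx : x ≤ Z) (hx' : x⁻¹ ≤ Z) (hy : y ≤ Z) (hy' : y⁻¹ ≤ Z)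
    (hxZ : Commute x Z) (hyZ : Commute y Z) (n : ℕ) : ⁅x ^ n, y ^ n⁆ ≤ Z ^ (4 * n) := by
  rw [commutatorElement_def, ← inv_pow, ← inv_pow]
  have h := mul_le_pow_add_of_commute
    (mul_le_pow_add_of_commute (mul_le_pow_add_of_commute (pow_le_pow_of_commute hx hxZ n)
      (pow_le_pow_of_commute hy hyZ n) (hxZ.pow_left n)) 
      (pow_le_pow_of_commute hx' hxZ.inv_left n) ((hxZ.pow_left n).mul_left (hyZ.pow_left n)))
    (pow_le_pow_of_commute hy' hyZ.inv_left n)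
    (((hxZ.pow_left n).mul_left (hyZ.pow_left n)).mul_left (hxZ.inv_left.pow_left n))
  convert h using 2
  ring

/-- In a left-ordered Heisenberg group, the central generator is dominated by one of the two
other generators. -/
theorem eq_one_of_commutatorElement_eq_zpow_of_max_le {G : Type*} [Group G] [LinearOrder G]
    [MulLeftMono G] {x y z : G} {k : ℤ} (hk : k ≠ 0) (hxy : ⁅x, y⁆ = z ^ k)
    (hxz : Commute x z) (hyz : Commute y z) (hx : max x x⁻¹ ≤ max z z⁻¹)
    (hy : max y y⁻¹ ≤ max z z⁻¹) : z = 1 := by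
  by_contra hz
  set Z := max z z⁻¹ with hZ
  have hZz : Z = z ∨ Z = z⁻¹ := max_choice z z⁻¹
  have hZ1 : 1 < Z := by
    rcases lt_or_gt_of_ne hz with h | h
    · exact lt_max_of_lt_right (by simpa using mul_lt_mul_right h z⁻¹)
    · exact lt_max_of_lt_left h
  have hxZ : Commute x Z := by
    rcases hZz with h | h <;> rw [h]
    exacts [hxz, hxz.inv_right]
  have hyZ : Commute y Z := by
    rcases hZz with h | h <;> rw [h]
    exacts [hyz, hyz.inv_right]
  obtain ⟨hx, hx'⟩ := max_le_iff.1 hx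
  obtain ⟨hy, hy'⟩ := max_le_iff.1 hy
  have h₁ := commutatorElement_pow_le hx hx' hy hy' hxZ hyZ 5
  have h₂ := commutatorElement_pow_le hy hy' hx hx' hyZ hxZ 5
  have hcomm : ⁅x ^ 5, y ^ 5⁆ = z ^ (25 * k) := by
    have := commutatorElement_zpow_zpow hxy (hxz.zpow_right k) (hyz.zpow_right k) 5 5
    rw [← zpow_mul] at this
    rw [show 25 * k = k * (5 * 5) by ring, ← this]
    norm_cast
  rw [← commutatorElement_inv] at h₂
  rw [hcomm] at h₁ h₂
  have hmono : StrictMono fun n : ℤ => Z ^ n := strictMono_int_of_lt_succ fun n => by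
    simpa [zpow_add_one] using mul_lt_mul_right hZ1 (Z ^ n)
  have e (j : ℤ) : Z ^ j ≤ Z ^ (4 * 5) → j ≤ 20 := fun h =>
    hmono.le_iff_le.1 (h.trans_eq (zpow_natCast Z 20).symm)
  have hbound : 25 * k ≤ 20 ∧ -(25 * k) ≤ 20 := by
    rcases hZz with h | h
    · exact ⟨e _ (by rwa [← h] at h₁), e _ (by rwa [← h, ← zpow_neg] at h₂)⟩
    · have h' : z = Z⁻¹ := by rw [h, inv_inv]
      exact ⟨e _ (by rwa [h', inv_zpow, inv_inv] at h₂), e _ (by rwa [h', inv_zpow'] at h₁)⟩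
  omega

/-- A cyclic configuration of six Heisenberg relations is trivial in a left-ordered group. -/
theorem eq_one_of_cyclic_heisenberg {G : Type*} [Group G] [LinearOrder G] [MulLeftMono G]
    (a : Fin 6 → G) (hcomm : ∀ i, Commute (a i) (a (i + 1)))
    (hrel : ∀ i, ∃ k : ℤ, k ≠ 0 ∧ ⁅a i, a (i + 2)⁆ = a (i + 1) ^ k) (i : Fin 6) : a i = 1 := by
  obtain ⟨j, -, hj⟩ := Finset.exists_max_image Finset.univ (fun i => max (a i) (a i)⁻¹)
    ⟨0, Finset.mem_univ _⟩
  obtain ⟨j, rfl⟩ : ∃ j', j = j' + 1 := ⟨j - 1, by simp⟩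
  obtain ⟨k, hk, hrel⟩ := hrel j
  have h2 : j + 1 + 1 = j + 2 := by rw [add_assoc]; rfl
  have h1 : a (j + 1) = 1 := eq_one_of_commutatorElement_eq_zpow_of_max_le hk hrel (hcomm j)
    (h2 ▸ (hcomm (j + 1)).symm) (hj _ (Finset.mem_univ _)) (hj _ (Finset.mem_univ _))
  have hi := hj i (Finset.mem_univ _)
  rw [h1, inv_one, max_self, max_le_iff] at hi
  refine le_antisymm hi.1 ?_
  simpa using mul_le_mul_right hi.2 (a i)

theorem exists_linearOrder_mulLeftMono {G ι : Type*} [Group G] [LinearOrder ι] [WellFoundedLT ι]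
    (φ : G → ι → ℝ) (hφ : Function.Injective φ)
    (hmul : ∀ f, ∃ F : ℝ → ℝ, StrictMono F ∧ ∀ g i, φ (f * g) i = F (φ g i)) :
    ∃ _ : LinearOrder G, MulLeftMono G := by
  classical
  let o : LinearOrder G := LinearOrder.lift' (fun g => toLex (φ g)) (toLex.injective.comp hφ)
  refine ⟨o, ⟨fun f g h hgh => ?_⟩⟩
  obtain ⟨F, hF, hf⟩ := hmul f
  rcases eq_or_lt_of_le hgh with rfl | hlt
  · exact le_rfl
  refine le_of_lt (?_ : toLex (φ (f * g)) < toLex (φ (f * h)))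
  obtain ⟨i, hi, hi'⟩ := (show toLex (φ g) < toLex (φ h) from hlt)
  refine ⟨i, fun j hj => ?_, ?_⟩
  · have := hi j hj
    simp only [Pi.toLex_apply] at this ⊢
    rw [hf, hf, this]
  · simp only [Pi.toLex_apply] at hi' ⊢
    rw [hf, hf]
    exact hF hi'

theorem CircleDeg1Lift.exists_linearOrder_units :
    ∃ o : LinearOrder CircleDeg1Liftˣ, @MulLeftMono CircleDeg1Liftˣ _ o.toLE := by
  obtain ⟨ι, _, _, ⟨e⟩⟩ : ∃ (ι : Type) (_ : LinearOrder ι) (_ : WellFoundedLT ι),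
      Nonempty (ι ≃ ℝ) := by
    obtain ⟨o, h⟩ := exists_wellFoundedLT ℝ
    exact ⟨ℝ, o, h, ⟨Equiv.refl _⟩⟩
  refine exists_linearOrder_mulLeftMono (fun (g : CircleDeg1Liftˣ) i => g (e i))
    (fun f g h => ?_) fun f => ?_
  · ext x
    simpa using congrFun h (e.symm x)
  · exact ⟨f, (CircleDeg1Lift.toOrderIso f).strictMono, fun _ _ => rfl⟩

/-! ### Lifts of circle homeomorphisms -/

/-- `F` is a lift to the line of the circle homeomorphism `f`. -/
def CircleDeg1Lift.IsLiftOf (F : CircleDeg1Liftˣ) (f : UnitAddCircle ≃ₜ UnitAddCircle) : Prop :=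
  ∀ x : ℝ, f (x : UnitAddCircle) = ((F x : ℝ) : UnitAddCircle)

namespace CircleDeg1Lift.IsLiftOf

variable {F G : CircleDeg1Liftˣ} {f g : UnitAddCircle ≃ₜ UnitAddCircle}

theorem one : IsLiftOf 1 1 := fun _ => rfl

theorem mul (hF : IsLiftOf F f) (hG : IsLiftOf G g) : IsLiftOf (F * G) (f * g) := fun x =>
  (congrArg f (hG x)).trans (hF (G x))

theorem inv (hF : IsLiftOf F f) : IsLiftOf F⁻¹ f⁻¹ := fun x => by
  refine f.injective ((f.apply_symm_apply _).trans ?_)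
  rw [hF, units_apply_inv_apply]

theorem pow (hF : IsLiftOf F f) (n : ℕ) : IsLiftOf (F ^ n) (f ^ n) := by
  induction n with
  | zero => simpa using one
  | succ n ih => simpa only [pow_succ] using ih.mul hF

theorem zpow (hF : IsLiftOf F f) : ∀ n : ℤ, IsLiftOf (F ^ n) (f ^ n)
  | .ofNat n => by simpa using hF.pow n
  | .negSucc n => by simpa only [zpow_negSucc] using (hF.pow (n + 1)).inv

theorem commutatorElement (hF : IsLiftOf F f) (hG : IsLiftOf G g) : IsLiftOf ⁅F, G⁆ ⁅f, g⁆ :=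
  ((hF.mul hG).mul hF.inv).mul hG.inv

theorem eq_one (hF : IsLiftOf 1 f) : f = 1 := by
  refine Homeomorph.ext fun x => ?_
  induction x using QuotientAddGroup.induction_on with
  | H x => exact hF x

theorem exists_eq_add_int (hF : IsLiftOf F 1) : ∃ n : ℤ, ∀ x, F x = x + n := by
  have h : ∀ x, ∃ n : ℤ, F x = x + n := fun x => by
    have hx : ((x : ℝ) : UnitAddCircle) = ((F x : ℝ) : UnitAddCircle) := hF x
    obtain ⟨n, hn⟩ := AddCircle.coe_eq_zero_iff (p := (1 : ℝ)) |>.1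
      (show ((F x - x : ℝ) : UnitAddCircle) = 0 by rw [AddCircle.coe_sub, ← hx, sub_self])
    exact ⟨n, by simp at hn; linarith⟩
  choose n hn using h
  have hmono : StrictMono F := (toOrderIso F).strictMono
  have hper : ∀ x, n (x - ⌊x⌋) = n x := fun x => by
    have := map_sub_int (F : CircleDeg1Lift) x ⌊x⌋
    rw [hn, hn] at this
    exact_mod_cast (by linarith : (n (x - ⌊x⌋) : ℝ) = n x)
  have hfract : ∀ x, 0 ≤ x → x < 1 → n x = n 0 := fun x hx hx1 => by
    have h₁ : F 0 ≤ F x := hmono.monotone hx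
    have h₂ : F x < F (0 + 1) := hmono (by linarith)
    rw [map_add_one] at h₂
    rw [hn 0, hn x] at h₁ h₂
    have h₃ : (n 0 : ℝ) < n x + 1 := by linarith
    have h₄ : (n x : ℝ) < n 0 + 1 := by linarith
    norm_cast at h₃ h₄
    omega
  refine ⟨n 0, fun x => ?_⟩
  rw [hn x, ← hper x, hfract (x - ⌊x⌋) (Int.fract_nonneg x) (Int.fract_lt_one x)]

theorem commute_of_one (hF : IsLiftOf F 1) (G : CircleDeg1Liftˣ) : Commute F G := by
  obtain ⟨n, hn⟩ := hF.exists_eq_add_int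
  refine Units.ext (CircleDeg1Lift.ext fun x => ?_)
  simp only [Units.val_mul, mul_apply, hn, map_add_int]

theorem commutatorElement_eq_of_eq {F' G' : CircleDeg1Liftˣ} (hF : IsLiftOf F f)
    (hF' : IsLiftOf F' f) (hG : IsLiftOf G g) (hG' : IsLiftOf G' g) : ⁅F, G⁆ = ⁅F', G'⁆ := by
  have hD : ∀ H, Commute (F'⁻¹ * F) H :=
    (show IsLiftOf (F'⁻¹ * F) 1 by simpa using hF'.inv.mul hF).commute_of_one
  have hE : ∀ H, Commute (G'⁻¹ * G) H :=
    (show IsLiftOf (G'⁻¹ * G) 1 by simpa using hG'.inv.mul hG).commute_of_one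
  obtain ⟨D, rfl⟩ : ∃ D, F = F' * D := ⟨F'⁻¹ * F, by group⟩
  obtain ⟨E, rfl⟩ : ∃ E, G = G' * E := ⟨G'⁻¹ * G, by group⟩
  simp only [inv_mul_cancel_left] at hD hE
  calc ⁅F' * D, G' * E⁆ = F' * (D * (G' * E)) * D⁻¹ * F'⁻¹ * (E⁻¹ * G'⁻¹) := by
        rw [commutatorElement_def]; group
    _ = F' * G' * (E * F'⁻¹) * E⁻¹ * G'⁻¹ := by rw [(hD _).eq]; group
    _ = ⁅F', G'⁆ := by rw [(hE _).eq, commutatorElement_def]; group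

/-- Lifts of commuting circle homeomorphisms commute. -/
theorem commute (hF : IsLiftOf F f) (hG : IsLiftOf G g) (h : Commute f g) : Commute F G := by
  have hD : IsLiftOf ⁅F, G⁆ 1 := by
    simpa only [commutatorElement_eq_one_iff_commute.2 h] using hF.commutatorElement hG
  obtain ⟨n, hn⟩ := hD.exists_eq_add_int
  have hconj : F * G * F⁻¹ = ⁅F, G⁆ * G := by rw [commutatorElement_def]; group
  have hτ := translationNumber_conj_eq F G
  rw [← Units.val_mul, ← Units.val_mul, hconj, Units.val_mul,
    translationNumber_mul_of_commute (Commute.units_val (hD.commute_of_one G)),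
    translationNumber_of_eq_add_int _ (hn 0)] at hτ
  have hn0 : n = 0 := by exact_mod_cast (by linarith : (n : ℝ) = 0)
  rw [← commutatorElement_eq_one_iff_commute]
  refine Units.ext (CircleDeg1Lift.ext fun x => ?_)
  simp [hn, hn0]

end CircleDeg1Lift.IsLiftOf

theorem IsC1Lift.exists_isLiftOf_sq {f : UnitAddCircle ≃ₜ UnitAddCircle} {F : ℝ → ℝ}
    (hF : IsC1Lift f F) : ∃ G : CircleDeg1Liftˣ, CircleDeg1Lift.IsLiftOf G (f ^ 2) := by
  obtain ⟨hC, hd, hper, hlift⟩ := hF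
  have hinj : Function.Injective F := by
    refine Function.Injective.of_lt_imp_ne fun x y hxy h => ?_
    obtain ⟨c, -, hc⟩ := exists_deriv_eq_zero hxy hC.continuous.continuousOn h
    exact hd c hc
  have hmono : StrictMono (F ∘ F) := by
    rcases hC.continuous.strictMono_of_inj hinj with h | h
    exacts [h.comp h, h.comp h]
  have hadd : ∀ x, (F ∘ F) (x + 1) = (F ∘ F) x + 1 := fun x => by
    rcases hper with h | h
    · simp [h]
    · have := h (F x - 1)
      simp only [sub_add_cancel] at this
      simp only [Function.comp_apply, h]
      linarith
  let G : CircleDeg1Lift := ⟨⟨F ∘ F, hmono.monotone⟩, hadd⟩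
  have hG : Continuous G := hC.continuous.comp hC.continuous
  obtain ⟨u, hu⟩ := CircleDeg1Lift.isUnit_iff_bijective.2
    ⟨hmono.injective, (CircleDeg1Lift.continuous_iff_surjective G).1 hG⟩
  refine ⟨u, fun x => ?_⟩
  rw [hu, sq]
  exact (congrArg f (hlift x)).trans (hlift (F x))

/-- In a `C¹` action on the circle, a cyclic configuration of six Heisenberg relations has
finite order. -/
theorem IsC1Action.map_zpow_eq_one_of_cyclic_heisenberg {Γ : Type*} [Group Γ]
    {ρ : Γ →* (UnitAddCircle ≃ₜ UnitAddCircle)} (hρ : IsC1Action ρ) (c : Fin 6 → Γ)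
    (hcomm : ∀ i, Commute (c i) (c (i + 1))) (k : Fin 6 → ℤ) (hk : ∀ i, k i ≠ 0)
    (hrel : ∀ i, ⁅c i, c (i + 2)⁆ = c (i + 1) ^ k i) (i : Fin 6) :
    ρ (c (i + 1) ^ (4 * k i)) = 1 := by
  have hassoc : ∀ i : Fin 6, i + 1 + 1 = i + 2 := fun i => by rw [add_assoc]; rfl
  have hlift : ∀ i, ∃ A : CircleDeg1Liftˣ, CircleDeg1Lift.IsLiftOf A (ρ (c i ^ 2)) := fun i => by
    obtain ⟨F, hF⟩ := hρ (c i)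
    simpa only [map_pow] using hF.exists_isLiftOf_sq
  choose A hA using hlift
  have hrel2 : ∀ i, ⁅c i ^ 2, c (i + 2) ^ 2⁆ = (c (i + 1) ^ 2) ^ (2 * k i) := fun i => by
    have := commutatorElement_zpow_zpow (hrel i) ((hcomm i).zpow_right _)
      ((hassoc i ▸ (hcomm (i + 1)).symm).zpow_right _) 2 2
    rw [← zpow_mul] at this
    norm_cast at this
    rw [this, ← zpow_natCast, ← zpow_mul]
    congr 1
    push_cast
    ring
  let B : Fin 6 → CircleDeg1Liftˣ := fun i => ⁅A i, A (i + 2)⁆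
  have hB : ∀ i, CircleDeg1Lift.IsLiftOf (B i) (ρ (c (i + 1) ^ 2) ^ (2 * k i)) := fun i => by
    have := (hA i).commutatorElement (hA (i + 2))
    rwa [← map_commutatorElement, hrel2, map_zpow] at this
  have hcommρ : ∀ i, Commute (ρ (c i ^ 2)) (ρ (c (i + 1) ^ 2)) := fun i =>
    (((hcomm i).pow_left 2).pow_right 2).map ρ
  have hBA : ∀ i, Commute (A i) (B i) := fun i =>
    (hA i).commute (hB i) ((hcommρ i).zpow_right _)
  have hBA' : ∀ i, Commute (A (i + 2)) (B i) := fun i =>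
    (hA (i + 2)).commute (hB i) ((hassoc i ▸ (hcommρ (i + 1)).symm).zpow_right _)
  have hBB : ∀ i, Commute (B i) (B (i + 1)) := fun i =>
    (hB i).commute (hB (i + 1)) (((hcommρ (i + 1)).zpow_left _).zpow_right _)
  have hBrel : ∀ i, ∃ l : ℤ, l ≠ 0 ∧ ⁅B i, B (i + 2)⁆ = B (i + 1) ^ l := fun i => by
    refine ⟨2 * k i * (2 * k (i + 2)), by simp [hk], ?_⟩
    have h3 : i + 2 + 1 = i + 1 + 2 := by rw [add_assoc, add_assoc, add_comm 2]
    have hB2 := hB (i + 2)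
    rw [h3] at hB2
    rw [(hB i).commutatorElement_eq_of_eq ((hA (i + 1)).zpow _) hB2 ((hA (i + 1 + 2)).zpow _)]
    exact commutatorElement_zpow_zpow rfl (hBA (i + 1)) (hBA' (i + 1)) _ _
  obtain ⟨o, ho⟩ := CircleDeg1Lift.exists_linearOrder_units
  have h1 : B i = 1 := @eq_one_of_cyclic_heisenberg _ _ o ho B hBB hBrel i
  have := (h1 ▸ hB i).eq_one
  rw [map_zpow]
  rw [map_pow, ← zpow_natCast, ← zpow_mul] at this
  rw [← this]
  congr 1
  push_cast
  ring

/-! ### Elementary matrices -/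

namespace Matrix.SpecialLinearGroup

variable {ι R : Type*} [Fintype ι] [DecidableEq ι] [CommRing R]

theorem eq_of_forall_smul_eq {A B : SpecialLinearGroup ι R} (h : ∀ x : ι → R, A • x = B • x) :
    A = B :=
  Subtype.ext (Matrix.ext_of_mulVec_single fun i => h (Pi.single i 1))

theorem transvection_smul {i j : ι} (hij : i ≠ j) (c : R) (x : ι → R) :
    transvection hij c • x = x + Pi.single i (c * x j) := by
  change (transvection hij c).1 *ᵥ x = _
  rw [transvection_coe, Matrix.add_mulVec, Matrix.one_mulVec]
  congr 1
  rw [Matrix.single_mulVec, Pi.single]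

theorem transvection_zpow {i j : ι} (hij : i ≠ j) (c : R) (k : ℤ) :
    transvection hij c ^ k = transvection hij (k * c) := by
  induction k using Int.induction_on with
  | zero => simp [transvection_coeff_zero]
  | succ k ih => rw [_root_.zpow_add_one, ih, ← transvection_add]; push_cast; ring_nf
  | pred k ih =>
    rw [_root_.zpow_sub_one, ih, transvection_inv, ← transvection_add]
    push_cast
    ring_nf

theorem commute_transvection {i j k l : ι} (hij : i ≠ j) (hkl : k ≠ l) (hjk : j ≠ k) (hil : i ≠ l)
    (b c : R) : Commute (transvection hij b) (transvection hkl c) := by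
  refine eq_of_forall_smul_eq fun x => ?_
  simp only [mul_smul, transvection_smul, Pi.add_apply, Pi.single_eq_of_ne hjk,
    Pi.single_eq_of_ne hil.symm, add_zero]
  abel

theorem commutatorElement_transvection {i j k : ι} (hij : i ≠ j) (hjk : j ≠ k) (hik : i ≠ k)
    (b c : R) : ⁅transvection hij b, transvection hjk c⁆ = transvection hik (b * c) := by
  rw [commutatorElement_def, mul_inv_eq_iff_eq_mul, mul_inv_eq_iff_eq_mul]
  refine eq_of_forall_smul_eq fun x => ?_
  simp only [mul_smul, transvection_smul, Pi.add_apply, Pi.single_eq_same,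
    Pi.single_eq_of_ne hik.symm, Pi.single_eq_of_ne hjk.symm,
    add_zero, mul_add, Pi.single_add, mul_assoc]
  abel

theorem exists_mem_forall_smul_eq_add_smul (H : Subgroup (SpecialLinearGroup ι R)) {j : ι}
    {u : ι → R} (hu : u j = 0) (h : ∀ i (hij : i ≠ j), transvection hij (u i) ∈ H) :
    ∃ g ∈ H, ∀ x : ι → R, g • x = x + x j • u := by
  have key : ∀ s : Finset ι, ∃ g ∈ H, ∀ x : ι → R,
      g • x = x + x j • ∑ i ∈ s, Pi.single i (u i) := fun s => by
    induction s using Finset.induction_on with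
    | empty => exact ⟨1, one_mem _, by simp⟩
    | insert i s his ih =>
      obtain ⟨g, hg, hgx⟩ := ih
      rcases eq_or_ne i j with rfl | hij
      · exact ⟨g, hg, by simpa [Finset.sum_insert his, hu] using hgx⟩
      · refine ⟨g * transvection hij (u i), mul_mem hg (h i hij), fun x => ?_⟩
        rw [mul_smul, hgx, transvection_smul, Finset.sum_insert his, smul_add]
        simp only [Pi.add_apply, Pi.single_eq_of_ne hij.symm, add_zero]
        rw [← Pi.single_smul, smul_eq_mul, mul_comm, add_assoc]
  simpa only [Finset.univ_sum_single] using key Finset.univ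

theorem exists_mem_forall_smul_eq_add_single (H : Subgroup (SpecialLinearGroup ι R)) {i : ι}
    {w : ι → R} (hw : w i = 0) (h : ∀ j (hij : i ≠ j), transvection hij (w j) ∈ H) :
    ∃ g ∈ H, ∀ x : ι → R, g • x = x + Pi.single i (w ⬝ᵥ x) := by
  have key : ∀ s : Finset ι, ∃ g ∈ H, ∀ x : ι → R,
      g • x = x + Pi.single i (∑ j ∈ s, w j * x j) := fun s => by
    induction s using Finset.induction_on with
    | empty => exact ⟨1, one_mem _, by simp⟩
    | insert j s hjs ih =>
      obtain ⟨g, hg, hgx⟩ := ih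
      rcases eq_or_ne i j with rfl | hij
      · exact ⟨g, hg, by simpa [Finset.sum_insert hjs, hw] using hgx⟩
      · refine ⟨transvection hij (w j) * g, mul_mem (h j hij) hg, fun x => ?_⟩
        rw [mul_smul, hgx, transvection_smul, Finset.sum_insert hjs, Pi.single_add]
        simp only [Pi.add_apply, Pi.single_eq_of_ne hij.symm, add_zero]
        abel
  exact key Finset.univ

/-- If `A` fixes `e_i` and is congruent to `1` modulo the coefficients of the transvections in
`H`, then `A` commutes with `1 + c E_{ij}` modulo `H`. -/
theorem commutatorElement_mem_of_smul_single_eq (H : Subgroup (SpecialLinearGroup ι R)) {m : R}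
    (hH : ∀ (i j : ι) (hij : i ≠ j) (c : R), transvection hij (m * c) ∈ H)
    {A : SpecialLinearGroup ι R} {i j : ι} (hij : i ≠ j)
    (hA : A • (Pi.single i 1 : ι → R) = Pi.single i 1)
    (hAm : ∀ k l, m ∣ (A⁻¹ : SpecialLinearGroup ι R) k l - (1 : Matrix ι ι R) k l) (c : R) :
    ⁅A, transvection hij c⁆ ∈ H := by
  have hrow : ∀ x : ι → R, (A⁻¹ • x) j = (fun k => (A⁻¹ : SpecialLinearGroup ι R) j k) ⬝ᵥ x :=
    fun x => rfl
  have hAi : (A⁻¹ : SpecialLinearGroup ι R) j i = 0 := by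
    have h : A⁻¹ • (Pi.single i 1 : ι → R) = Pi.single i 1 := by rw [inv_smul_eq_iff, hA]
    simpa [hij.symm, hrow] using congrFun h j
  obtain ⟨g, hg, hgx⟩ := exists_mem_forall_smul_eq_add_single H (i := i)
    (w := fun k => c * ((A⁻¹ : SpecialLinearGroup ι R) j k - (1 : Matrix ι ι R) j k))
    (by simp [hAi, hij.symm]) fun k hik => by
      obtain ⟨d, hd⟩ := hAm j k
      rw [hd, mul_left_comm]
      exact hH _ _ _ _
  convert hg
  rw [commutatorElement_def, mul_inv_eq_iff_eq_mul]
  refine eq_of_forall_smul_eq fun x => ?_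
  have hone : (fun k => (1 : Matrix ι ι R) j k) ⬝ᵥ x = x j := by
    simp [dotProduct, Matrix.one_apply]
  have hdot : ∀ y : ι → R, (fun k => c * ((A⁻¹ : SpecialLinearGroup ι R) j k -
      (1 : Matrix ι ι R) j k)) ⬝ᵥ y = c * ((A⁻¹ • y) j - y j) := fun y => by
    rw [hrow]
    simp only [dotProduct, mul_sub, sub_mul, Finset.sum_sub_distrib, Finset.mul_sum, mul_assoc]
    simp [Matrix.one_apply]
  have hsingle : ∀ r : R, A • (Pi.single i r : ι → R) = Pi.single i r := fun r => by
    rw [show (Pi.single i r : ι → R) = r • Pi.single i 1 by rw [← Pi.single_smul]; simp,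
      smul_comm, hA]
  have hsingle' : ∀ r : R, A⁻¹ • (Pi.single i r : ι → R) = Pi.single i r := fun r => by
    rw [inv_smul_eq_iff, hsingle]
  rw [mul_smul, mul_smul, mul_smul, hgx, hdot, transvection_smul, transvection_smul, smul_add,
    smul_inv_smul, hsingle, smul_add, hsingle', add_assoc, ← Pi.single_add]
  congr 2
  simp only [Pi.add_apply, Pi.single_eq_of_ne hij.symm]
  ring

end Matrix.SpecialLinearGroup

/-! ### Generation of `SL(n, ℤ)` by elementary matrices -/

namespace Matrix.SpecialLinearGroup

variable {ι : Type*} [Fintype ι] [DecidableEq ι]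

theorem exists_mem_smul_apply_eq_zero {H : Subgroup (SpecialLinearGroup ι ℤ)}
    (hH : ∀ (i j : ι) (hij : i ≠ j) (c : ℤ), transvection hij c ∈ H) {i p : ι} (hip : i ≠ p)
    (v : ι → ℤ) :
    ∃ g ∈ H, (∀ x : ι → ℤ, x i = 0 → x p = 0 → g • x = x) ∧ (g • v) i = 0 ∧
      ∀ k, k ≠ i → k ≠ p → (g • v) k = v k := by
  induction hn : (v i).natAbs using Nat.strong_induction_on generalizing v with
  | _ n ih =>
    by_cases hv : v i = 0
    · exact ⟨1, one_mem _, by simp [hv]⟩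
    · set g₀ := transvection hip 1 * transvection hip.symm (-1) * transvection hip 1 *
        transvection hip.symm (-(v p / v i)) with hg₀
      have hfix : ∀ x : ι → ℤ, x i = 0 → x p = 0 → g₀ • x = x := fun x hi hp => by
        simp [hg₀, mul_smul, transvection_smul, hi, hp]
      have hi : (g₀ • v) i = v p % v i := by
        simp only [hg₀, mul_smul, transvection_smul, Pi.add_apply, Pi.single_eq_same,
          Pi.single_eq_of_ne hip, Pi.single_eq_of_ne hip.symm, Int.emod_def]
        ring
      have hother : ∀ k, k ≠ i → k ≠ p → (g₀ • v) k = v k := fun k hki hkp => by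
        simp [hg₀, mul_smul, transvection_smul, hki, hkp]
      have hlt : ((g₀ • v) i).natAbs < n := by
        rw [hi, ← hn, ← Int.ofNat_lt, Int.natCast_natAbs, Int.natCast_natAbs,
          abs_of_nonneg (Int.emod_nonneg _ hv)]
        exact Int.emod_lt_abs _ hv
      obtain ⟨g, hg, hgx, hgi, hgk⟩ := ih _ hlt (g₀ • v) rfl
      refine ⟨g * g₀, mul_mem hg ?_, fun x h₁ h₂ => ?_, ?_, fun k h₁ h₂ => ?_⟩
      · exact mul_mem (mul_mem (mul_mem (hH _ _ _ _) (hH _ _ _ _)) (hH _ _ _ _)) (hH _ _ _ _)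
      · rw [mul_smul, hfix x h₁ h₂, hgx x h₁ h₂]
      · rw [mul_smul, hgi]
      · rw [mul_smul, hgk k h₁ h₂, hother k h₁ h₂]

theorem exists_mem_forall_smul_apply_eq_zero {H : Subgroup (SpecialLinearGroup ι ℤ)}
    (hH : ∀ (i j : ι) (hij : i ≠ j) (c : ℤ), transvection hij c ∈ H) (p : ι) (T : Finset ι)
    (v : ι → ℤ) :
    ∃ g ∈ H, (∀ x : ι → ℤ, x p = 0 → (∀ i ∈ T, x i = 0) → g • x = x) ∧
      ∀ i ∈ T, i ≠ p → (g • v) i = 0 := by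
  induction T using Finset.induction_on with
  | empty => exact ⟨1, one_mem _, by simp⟩
  | insert i T _ ih =>
    obtain ⟨g, hg, hgx, hgv⟩ := ih
    rcases eq_or_ne i p with rfl | hip
    · exact ⟨g, hg, fun x hx h => hgx x hx fun i hi => h i (Finset.mem_insert_of_mem hi),
        fun j hj hji => hgv j (Finset.mem_of_mem_insert_of_ne hj hji) hji⟩
    · obtain ⟨g', hg', hgx', hgi', hgk'⟩ := exists_mem_smul_apply_eq_zero hH hip (g • v)
      refine ⟨g' * g, mul_mem hg' hg, fun x hx h => ?_, fun j hj hjp => ?_⟩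
      · rw [mul_smul, hgx x hx fun i hi => h i (Finset.mem_insert_of_mem hi),
          hgx' x (h i (Finset.mem_insert_self _ _)) hx]
      · rw [mul_smul]
        rcases eq_or_ne j i with rfl | hji
        · exact hgi'
        · rw [hgk' j hji hjp, hgv j (Finset.mem_of_mem_insert_of_ne hj hji) hjp]

theorem exists_mem_mul_smul_single_eq {H : Subgroup (SpecialLinearGroup ι ℤ)}
    (hH : ∀ (i j : ι) (hij : i ≠ j) (c : ℤ), transvection hij c ∈ H) {p : ι} {T : Finset ι}
    (hp : p ∉ T) {A : SpecialLinearGroup ι ℤ}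
    (hA : ∀ k ∉ insert p T, A • (Pi.single k 1 : ι → ℤ) = Pi.single k 1) :
    ∃ g ∈ H, ∀ k ∉ T, (g * A) • (Pi.single k 1 : ι → ℤ) = Pi.single k 1 := by
  obtain ⟨g₁, hg₁, hgx, hgv⟩ :=
    exists_mem_forall_smul_apply_eq_zero hH p T (A • Pi.single p 1)
  rw [← mul_smul] at hgv
  set B := g₁ * A with hB
  have hBk : ∀ k ∉ insert p T, B • (Pi.single k 1 : ι → ℤ) = Pi.single k 1 := fun k hk => by
    rw [hB, mul_smul, hA k hk]
    simp only [Finset.mem_insert, not_or] at hk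
    exact hgx _ (by simp [Ne.symm hk.1]) fun i hi => by
      simp [ne_of_mem_of_not_mem hi hk.2]
  set v : ι → ℤ := B • Pi.single p 1 with hv
  have hd : v p * v p = 1 := by
    have hw : ∀ k ∉ insert p T, (B⁻¹ : SpecialLinearGroup ι ℤ) p k = 0 := fun k hk => by
      have h := congrFun (inv_smul_eq_iff.2 (hBk k hk).symm) p
      have hpk : p ≠ k := fun h => hk (h ▸ Finset.mem_insert_self _ _)
      rw [Pi.single_eq_of_ne hpk] at h
      rw [← h]
      exact (congrFun (Matrix.mulVec_single_one (B⁻¹).1 k) p).symm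
    have h : ∑ k, (B⁻¹ : SpecialLinearGroup ι ℤ) p k * v k = 1 := by
      have := congrFun (inv_smul_smul B (Pi.single p 1 : ι → ℤ)) p
      rwa [Pi.single_eq_same] at this
    rw [Finset.sum_eq_single p] at h
    · rcases Int.mul_eq_one_iff_eq_one_or_neg_one.1 h with h | h <;> simp [h.2]
    · intro k _ hkp
      by_cases hk : k ∈ T
      · rw [hgv k hk hkp, mul_zero]
      · rw [hw k (by simp [hk, hkp]), zero_mul]
    · simp
  obtain ⟨g₂, hg₂, hg₂x⟩ := exists_mem_forall_smul_eq_add_smul H (j := p)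
    (u := Pi.single p 1 - v p • v) (by simp [hd]) fun i hi => hH _ _ _ _
  have hCk : ∀ k ∉ insert p T, (g₂ * B) • (Pi.single k 1 : ι → ℤ) = Pi.single k 1 :=
    fun k hk => by
      have hpk : p ≠ k := fun h => hk (h ▸ Finset.mem_insert_self _ _)
      rw [mul_smul, hBk k hk, hg₂x, Pi.single_eq_of_ne hpk, zero_smul, add_zero]
  have hCp : (g₂ * B) • (Pi.single p 1 : ι → ℤ) = Pi.single p (v p) := by
    rw [mul_smul, ← hv, hg₂x, smul_sub, smul_smul, hd, one_smul, add_sub_cancel,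
      ← Pi.single_smul]
    simp
  rcases mul_self_eq_one_iff.1 hd with h1 | h1
  · refine ⟨g₂ * g₁, mul_mem hg₂ hg₁, fun k hk => ?_⟩
    rw [mul_assoc, ← hB]
    rcases eq_or_ne k p with rfl | hkp
    · rw [hCp, h1]
    · exact hCk k (by simp [hk, hkp])
  rw [h1] at hCp
  rcases T.eq_empty_or_nonempty with rfl | ⟨r, hr⟩
  · have hdiag : (g₂ * B).1 = Matrix.diagonal (fun k => if k = p then (-1 : ℤ) else 1) := by
      refine Matrix.ext_of_mulVec_single fun k => ?_
      rw [Matrix.diagonal_mulVec_single]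
      rcases eq_or_ne k p with rfl | hkp
      · exact hCp.trans (by simp)
      · exact (hCk k (by simp [hkp])).trans (by simp [hkp])
    have hdet := (g₂ * B).2
    rw [hdiag, Matrix.det_diagonal, Finset.prod_ite_eq' Finset.univ p] at hdet
    simp at hdet
  · have hrp : r ≠ p := ne_of_mem_of_not_mem hr hp
    refine ⟨transvection hrp 1 * transvection hrp.symm (-2) * transvection hrp 1 * (g₂ * g₁),
      mul_mem (mul_mem (mul_mem (hH _ _ _ _) (hH _ _ _ _)) (hH _ _ _ _)) (mul_mem hg₂ hg₁),
      fun k hk => ?_⟩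
    rw [mul_assoc, mul_assoc g₂, ← hB, mul_smul]
    rcases eq_or_ne k p with rfl | hkp
    · rw [hCp]
      ext l
      simp only [mul_smul, transvection_smul, Pi.add_apply, Pi.single_apply, hrp, hrp.symm]
      split_ifs <;> simp_all
    · rw [hCk k (by simp [hk, hkp])]
      have hkr : r ≠ k := ne_of_mem_of_not_mem hr hk
      simp [mul_smul, transvection_smul, hkp.symm, hkr]

theorem eq_top_of_forall_transvection_mem {H : Subgroup (SpecialLinearGroup ι ℤ)}
    (hH : ∀ (i j : ι) (hij : i ≠ j) (c : ℤ), transvection hij c ∈ H) : H = ⊤ := by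
  have key : ∀ (T : Finset ι) (A : SpecialLinearGroup ι ℤ),
      (∀ k ∉ T, A • (Pi.single k 1 : ι → ℤ) = Pi.single k 1) → A ∈ H := fun T => by
    induction T using Finset.induction_on with
    | empty =>
      intro A hA
      have : A = 1 := Subtype.ext <| Matrix.ext_of_mulVec_single fun k =>
        (hA k (Finset.notMem_empty k)).trans (Matrix.one_mulVec _).symm
      exact this ▸ one_mem H
    | insert p T hp ih =>
      intro A hA
      obtain ⟨g, hg, hgA⟩ := exists_mem_mul_smul_single_eq hH hp hA
      exact (H.mul_mem_cancel_left hg).1 (ih _ hgA)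
  exact (Subgroup.eq_top_iff' H).2 fun A => key Finset.univ A (by simp)

end Matrix.SpecialLinearGroup

/-! ### Normal subgroups containing an elementary congruence subgroup -/

theorem Int.exists_isCoprime_add_mul {a b c x y z : ℤ} (ha : a ≠ 0)
    (h : x * a + y * b + z * c = 1) : ∃ t, IsCoprime a (b + t * c) := by
  refine ⟨∏ p ∈ a.natAbs.primeFactors with ¬ ((p : ℕ) : ℤ) ∣ b, (p : ℤ),
    isCoprime_of_prime_dvd (by simp [ha]) fun q hq hqa hqb => ?_⟩
  set t : ℤ := ∏ p ∈ a.natAbs.primeFactors with ¬ ((p : ℕ) : ℤ) ∣ b, (p : ℤ) with ht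
  by_cases hb : q ∣ b
  · have htc : q ∣ t * c := (dvd_add_right hb).1 hqb
    rcases hq.dvd_or_dvd htc with h' | h'
    · obtain ⟨p, hp, hqp⟩ := (hq.dvd_finsetProd_iff _).1 h'
      rw [Finset.mem_filter, Nat.mem_primeFactors] at hp
      have hass := hq.associated_of_dvd (Nat.prime_iff_prime_int.1 hp.1.1) hqp
      exact hp.2 (hass.dvd_iff_dvd_left.1 hb)
    · refine hq.not_isUnit (isUnit_of_dvd_one (h ▸ ?_))
      exact dvd_add (dvd_add (hqa.mul_left _) (hb.mul_left _)) (h'.mul_left _)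
  · refine hb ((dvd_add_left (Dvd.dvd.mul_right ?_ c)).1 hqb)
    have hmem : q.natAbs ∈ a.natAbs.primeFactors.filter fun p => ¬ ((p : ℕ) : ℤ) ∣ b := by
      rw [Finset.mem_filter, Nat.mem_primeFactors]
      exact ⟨⟨Int.prime_iff_natAbs_prime.1 hq, Int.natAbs_dvd_natAbs.2 hqa, by simpa using ha⟩,
        by rwa [Int.natAbs_dvd]⟩
    exact Int.natAbs_dvd.1 (Finset.dvd_prod_of_mem (fun p : ℕ => (p : ℤ)) hmem)

namespace Matrix.SpecialLinearGroup

variable {ι : Type*} [Fintype ι] [DecidableEq ι]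

theorem exists_mem_smul_eq_single {N : Subgroup (SpecialLinearGroup ι ℤ)} [N.Normal] {m : ℤ}
    (hN : ∀ (i j : ι) (hij : i ≠ j) (c : ℤ), transvection hij (m * c) ∈ N)
    {i j k : ι} (hij : i ≠ j) (hik : i ≠ k) (hjk : j ≠ k) {v w : ι → ℤ} (hvi : v i ≠ 0)
    (hwv : w ⬝ᵥ v = 1) (hv : ∀ l, m ∣ v l - (Pi.single i 1 : ι → ℤ) l) :
    ∃ g ∈ N, g • v = Pi.single i 1 := by
  have hv_ne : ∀ l, l ≠ i → m ∣ v l := fun l hl => by simpa [hl] using hv l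
  obtain ⟨a, ha⟩ : m ∣ v i - 1 := by simpa using hv i
  -- make the entries at `i` and `j` coprime
  obtain ⟨g₁, hg₁, v₁, hgv₁, hv₁i, hv₁, p, q, hpq⟩ : ∃ g₁ ∈ N, ∃ v₁ : ι → ℤ, g₁ • v = v₁ ∧
      v₁ i = v i ∧ (∀ l, l ≠ i → m ∣ v₁ l) ∧ IsCoprime (v₁ i) (v₁ j) := by
    set w' : ι → ℤ := Function.update (Function.update w i 0) j 0 with hw'
    have hsum : w i * v i + w j * v j + w' ⬝ᵥ v = 1 := by
      have : w = w' + Pi.single i (w i) + Pi.single j (w j) := by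
        ext l
        rcases eq_or_ne l j with rfl | hlj
        · simp [hw', hij.symm]
        · rcases eq_or_ne l i with rfl | hli
          · simp [hw', hij]
          · simp [hw', hlj, hli]
      rw [this, add_dotProduct, add_dotProduct, single_dotProduct, single_dotProduct] at hwv
      linarith
    obtain ⟨t, ht⟩ := Int.exists_isCoprime_add_mul (a := v i) (b := v j) (c := m * w' ⬝ᵥ v)
      (x := w i + w' ⬝ᵥ v) (y := w j) (z := -a) hvi
      (by linear_combination hsum + (w' ⬝ᵥ v) * ha)
    obtain ⟨g, hg, hgx⟩ := exists_mem_forall_smul_eq_add_single N (i := j) (w := (m * t) • w')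
      (by simp [hw']) fun l hl => by
        rw [Pi.smul_apply, smul_eq_mul, mul_assoc]
        exact hN _ _ _ _
    refine ⟨g, hg, _, hgx v, ?_, fun l hl => ?_, ?_⟩
    · simp [hij]
    · rcases eq_or_ne l j with rfl | hlj
      · rw [Pi.add_apply, Pi.single_eq_same, smul_dotProduct, smul_eq_mul, mul_assoc]
        exact dvd_add (hv_ne _ hl) (dvd_mul_right _ _)
      · simpa [hlj] using hv_ne l hl
    · convert ht using 1
      · simp [hij]
      · simp only [Pi.add_apply, Pi.single_eq_same, smul_dotProduct, smul_eq_mul]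
        ring
  -- make the entry at `k` equal to `m`
  obtain ⟨g₂, hg₂, v₂, hgv₂, hv₂i, hv₂, hv₂k⟩ : ∃ g₂ ∈ N, ∃ v₂ : ι → ℤ, g₂ • v₁ = v₂ ∧
      v₂ i = v₁ i ∧ (∀ l, l ≠ i → m ∣ v₂ l) ∧ v₂ k = m := by
    obtain ⟨b, hb⟩ := hv₁ k hik.symm
    obtain ⟨g, hg, hgx⟩ := exists_mem_forall_smul_eq_add_single N (i := k)
      (w := (m * (1 - b)) • (Pi.single i p + Pi.single j q)) (by simp [hik.symm, hjk.symm])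
      fun l hl => by
        rw [Pi.smul_apply, smul_eq_mul, mul_assoc]
        exact hN _ _ _ _
    have hk : (v₁ + Pi.single k
        (((m * (1 - b)) • (Pi.single i p + Pi.single j q : ι → ℤ)) ⬝ᵥ v₁) : ι → ℤ) k = m := by
      rw [Pi.add_apply, Pi.single_eq_same, smul_dotProduct, add_dotProduct, single_dotProduct,
        single_dotProduct, hpq, hb, smul_eq_mul]
      ring
    refine ⟨g, hg, _, hgx v₁, by simp [hik], fun l hl => ?_, hk⟩
    rcases eq_or_ne l k with rfl | hlk
    · rw [hk]
    · simpa [hlk] using hv₁ l hl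
  set e := transvection hik a
  set y : ι → ℤ := e⁻¹ • v₂ with hy
  have hyl : y = v₂ + Pi.single i (-a * v₂ k) := by
    rw [hy, transvection_inv, transvection_smul]
  have hyi : y i = 1 := by
    rw [hyl, Pi.add_apply, Pi.single_eq_same, hv₂k, hv₂i, hv₁i]
    linarith
  obtain ⟨h, hh, hhx⟩ := exists_mem_forall_smul_eq_add_smul N (j := i)
    (u := Pi.single i 1 - y) (by simp [hyi]) fun l hl => by
      obtain ⟨d, hd⟩ := hv₂ l hl
      have : (Pi.single i 1 - y : ι → ℤ) l = m * -d := by simp [hyl, hl, hd]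
      rw [this]
      exact hN _ _ _ _
  refine ⟨e * h * e⁻¹ * (g₂ * g₁), mul_mem (Subgroup.Normal.conj_mem ‹_› h hh e)
    (mul_mem hg₂ hg₁), ?_⟩
  rw [mul_smul, mul_smul g₂, hgv₁, hgv₂, mul_smul, ← hy, mul_smul, hhx, hyi, one_smul,
    add_sub_cancel]
  exact transvection_smul_single_fst hik a

end Matrix.SpecialLinearGroup

/-- A perfect group whose center has finite index is finite. -/
theorem Group.finite_of_perfect_of_finiteIndex_center {G : Type*} [Group G]
    (hG : _root_.commutator G = ⊤) [(Subgroup.center G).FiniteIndex] : Finite G := by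
  have : Finite (commutatorSet G) := by
    let f : (G ⧸ Subgroup.center G) × (G ⧸ Subgroup.center G) → G := fun p => ⁅p.1.out, p.2.out⁆
    refine ((Set.finite_range f).subset ?_).to_subtype
    rintro _ ⟨a, b, rfl⟩
    refine ⟨(a, b), ?_⟩
    obtain ⟨⟨s, hs⟩, hs'⟩ := QuotientGroup.mk_out_eq_mul (Subgroup.center G) a
    obtain ⟨⟨t, ht⟩, ht'⟩ := QuotientGroup.mk_out_eq_mul (Subgroup.center G) b
    simp only at hs' ht'
    rw [Subgroup.mem_center_iff] at hs ht
    simp only [f, hs', ht', commutatorElement_def, mul_inv_rev]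
    have h1 : a * s * (b * t) * (s⁻¹ * a⁻¹) * (t⁻¹ * b⁻¹) =
        a * (s * b) * (t * (s⁻¹ * a⁻¹)) * (t⁻¹ * b⁻¹) := by group
    rw [h1, ← hs b, ← ht (s⁻¹ * a⁻¹)]
    group
  have : Finite (⊤ : Subgroup G) := hG ▸ inferInstance
  exact Set.finite_univ_iff.1 (Set.toFinite ((⊤ : Subgroup G) : Set G))

namespace Matrix.SpecialLinearGroup

variable {ι : Type*} [Fintype ι] [DecidableEq ι]

theorem exists_ne_and_ne_of_two_lt_card (hι : 2 < Fintype.card ι) (i j : ι) :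
    ∃ k, k ≠ i ∧ k ≠ j := by
  obtain ⟨k, hk⟩ : ∃ k, k ∉ ({i, j} : Finset ι) := by
    by_contra! h
    have := Finset.card_le_two (a := i) (b := j)
    rw [Finset.eq_univ_iff_forall.2 h, Finset.card_univ] at this
    omega
  exact ⟨k, by simpa only [Finset.mem_insert, Finset.mem_singleton, not_or] using hk⟩

theorem dvd_sub_one_of_map_eq_one {m : ℕ} {A : SpecialLinearGroup ι ℤ}
    (hA : A ∈ (SpecialLinearGroup.map (n := ι) (Int.castRingHom (ZMod m))).ker) (i j : ι) :
    (m : ℤ) ∣ A i j - (1 : Matrix ι ι ℤ) i j := by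
  have h : ((A i j : ℤ) : ZMod m) = (1 : Matrix ι ι (ZMod m)) i j :=
    congrArg (fun B : SpecialLinearGroup ι (ZMod m) => B i j) (MonoidHom.mem_ker.1 hA)
  rw [← ZMod.intCast_zmod_eq_zero_iff_dvd]
  rw [Int.cast_sub, h, Matrix.one_apply, Matrix.one_apply]
  split_ifs <;> simp

theorem transvection_mem_ker_map {m : ℕ} {i j : ι} (hij : i ≠ j) (c : ℤ) :
    transvection hij (m * c) ∈
      (SpecialLinearGroup.map (n := ι) (Int.castRingHom (ZMod m))).ker := by
  rw [MonoidHom.mem_ker]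
  ext k l
  simp [transvection_coe, Matrix.one_apply, Matrix.single_apply]

theorem commutatorElement_transvection_mem {N : Subgroup (SpecialLinearGroup ι ℤ)} [N.Normal]
    (hι : 2 < Fintype.card ι) {m : ℕ} (hm : 2 ≤ m)
    (hN : ∀ (i j : ι) (hij : i ≠ j) (c : ℤ), transvection hij (m * c) ∈ N)
    (hNm : N ≤ (SpecialLinearGroup.map (n := ι) (Int.castRingHom (ZMod m))).ker)
    {A : SpecialLinearGroup ι ℤ}
    (hA : A ∈ (SpecialLinearGroup.map (n := ι) (Int.castRingHom (ZMod m))).ker)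
    {i j : ι} (hij : i ≠ j) (c : ℤ) : ⁅A, transvection hij c⁆ ∈ N := by
  obtain ⟨k, hki, hkj⟩ := exists_ne_and_ne_of_two_lt_card hι i j
  have hentry : ∀ l, (A • (Pi.single i 1 : ι → ℤ)) l = A l i := fun l =>
    congrFun (Matrix.mulVec_single_one A.1 i) l
  have hdvd : ∀ l, (m : ℤ) ∣ (A • (Pi.single i 1 : ι → ℤ)) l - (Pi.single i 1 : ι → ℤ) l :=
    fun l => by
      rw [hentry, Pi.single_apply]
      simpa [Matrix.one_apply] using dvd_sub_one_of_map_eq_one hA l i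
  obtain ⟨h, hh, hhA⟩ := exists_mem_smul_eq_single (N := N) hN hij hki.symm hkj.symm
    (v := A • Pi.single i 1) (w := fun l => (A⁻¹ : SpecialLinearGroup ι ℤ) i l)
    (fun h0 => by
      have := hdvd i
      rw [h0, Pi.single_eq_same, zero_sub, dvd_neg] at this
      have := Int.le_of_dvd one_pos this
      omega)
    ((congrFun (inv_smul_smul A (Pi.single i 1 : ι → ℤ)) i).trans (by simp)) hdvd
  rw [← mul_smul] at hhA
  have hmem := commutatorElement_mem_of_smul_single_eq N hN hij hhA
    (fun k l => dvd_sub_one_of_map_eq_one (inv_mem (mul_mem (hNm hh) hA)) k l) c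
  rw [← QuotientGroup.eq_one_iff] at hh hmem ⊢
  rwa [← QuotientGroup.mk'_apply, map_commutatorElement, map_mul, QuotientGroup.mk'_apply, hh,
    one_mul, ← map_commutatorElement] at hmem

/-- A normal subgroup of `SL(n, ℤ)`, `n ≥ 3`, containing the `m`-th powers of the elementary
matrices has finite index. -/
theorem finiteIndex_of_forall_transvection_mem (N : Subgroup (SpecialLinearGroup ι ℤ)) [N.Normal]
    (hι : 2 < Fintype.card ι) {m : ℕ} (hm : 2 ≤ m)
    (hN : ∀ (i j : ι) (hij : i ≠ j) (c : ℤ), transvection hij (m * c) ∈ N) :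
    N.FiniteIndex := by
  set Γ := (SpecialLinearGroup.map (n := ι) (Int.castRingHom (ZMod m))).ker with hΓ
  have : NeZero m := ⟨by omega⟩
  have : Γ.FiniteIndex := inferInstance
  set M := N ⊓ Γ with hM
  have hMΓ : M ≤ Γ := inf_le_right
  have hMt : ∀ (i j : ι) (hij : i ≠ j) (c : ℤ), transvection hij (m * c) ∈ M :=
    fun i j hij c => ⟨hN i j hij c, transvection_mem_ker_map hij c⟩
  let π := QuotientGroup.mk' M
  have hπ : Function.Surjective π := QuotientGroup.mk'_surjective M
  have hcenter : Γ ≤ (Subgroup.center (SpecialLinearGroup ι ℤ ⧸ M)).comap π := fun A hA => by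
    have htop : (Subgroup.centralizer {π A}).comap π = ⊤ :=
      eq_top_of_forall_transvection_mem fun i j hij c => by
        rw [Subgroup.mem_comap, Subgroup.mem_centralizer_singleton_iff]
        have := commutatorElement_transvection_mem hι hm hMt hMΓ hA hij c
        rw [← QuotientGroup.eq_one_iff, ← QuotientGroup.mk'_apply, map_commutatorElement,
          commutatorElement_eq_one_iff_mul_comm] at this
        exact this.symm
    rw [Subgroup.mem_comap, Subgroup.mem_center_iff]
    refine hπ.forall.2 fun B => ?_
    have hB : B ∈ (Subgroup.centralizer {π A}).comap π := htop ▸ Subgroup.mem_top B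
    exact Subgroup.mem_centralizer_singleton_iff.1 hB
  have hperfect : _root_.commutator (SpecialLinearGroup ι ℤ ⧸ M) = ⊤ := by
    have htop : (_root_.commutator (SpecialLinearGroup ι ℤ ⧸ M)).comap π = ⊤ :=
      eq_top_of_forall_transvection_mem fun i j hij c => by
        obtain ⟨k, hki, hkj⟩ := exists_ne_and_ne_of_two_lt_card hι i j
        rw [Subgroup.mem_comap, ← mul_one c, ← commutatorElement_transvection hki.symm hkj hij,
          map_commutatorElement, commutator_eq_closure]
        exact Subgroup.subset_closure (commutator_mem_commutatorSet _ _)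
    rw [← Subgroup.map_comap_eq_self_of_surjective hπ (_root_.commutator _), htop,
      Subgroup.map_top_of_surjective _ hπ]
  have : (Subgroup.center (SpecialLinearGroup ι ℤ ⧸ M)).FiniteIndex := by
    have := Subgroup.finiteIndex_of_le hcenter
    refine ⟨fun h => this.index_ne_zero ?_⟩
    rw [Subgroup.index_comap_of_surjective _ hπ, h]
  have := Group.finite_of_perfect_of_finiteIndex_center hperfect
  have : M.FiniteIndex := Subgroup.finiteIndex_of_finite_quotient
  exact Subgroup.finiteIndex_of_le (inf_le_left : M ≤ N)

end Matrix.SpecialLinearGroup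

/-! ### Actions of finite-index subgroups of `SL(n, ℤ)` -/

open Matrix.SpecialLinearGroup in
theorem IsC1Action.conj_transvection_mem_map_ker {ι : Type*} [Fintype ι] [DecidableEq ι]
    {K : Subgroup (Matrix.SpecialLinearGroup ι ℤ)} {ρ : K →* (UnitAddCircle ≃ₜ UnitAddCircle)}
    (hρ : IsC1Action ρ) {M : ℕ} (hM : M ≠ 0)
    (hK : ∀ x : Matrix.SpecialLinearGroup ι ℤ, x ^ M ∈ K) {i j k : ι} (hij : i ≠ j) (hik : i ≠ k)
    (hjk : j ≠ k) (γ : Matrix.SpecialLinearGroup ι ℤ) (c : ℤ) :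
    γ * Matrix.SpecialLinearGroup.transvection hik ((4 * M * M : ℕ) * c) * γ⁻¹ ∈
      ρ.ker.map K.subtype := by
  let e : Fin 6 → Matrix.SpecialLinearGroup ι ℤ :=
    ![transvection hij 1, transvection hik 1, transvection hjk 1, transvection hij.symm 1,
      transvection hik.symm 1, transvection hjk.symm 1]
  let a : Fin 6 → Matrix.SpecialLinearGroup ι ℤ := fun l => MulAut.conj γ (e l)
  let s : Fin 6 → ℤ := ![1, -1, 1, -1, 1, -1]
  have ha : ∀ l, Commute (a l) (a (l + 1)) := fun l => by
    refine Commute.map ?_ (MulAut.conj γ)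
    fin_cases l
    · exact commute_transvection hij hik hij.symm hik 1 1
    · exact commute_transvection hik hjk hjk.symm hik 1 1
    · exact commute_transvection hjk hij.symm hjk.symm hij.symm 1 1
    · exact commute_transvection hij.symm hik.symm hik hij.symm 1 1
    · exact commute_transvection hik.symm hjk.symm hik hjk.symm 1 1
    · exact commute_transvection hjk.symm hij hij.symm hjk.symm 1 1
  have hpos : ∀ {p q r : ι} (hpq : p ≠ q) (hqr : q ≠ r) (hpr : p ≠ r),
      ⁅transvection hpq (1 : ℤ), transvection hqr (1 : ℤ)⁆ = transvection hpr (1 : ℤ) ^ (1 : ℤ) :=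
    fun hpq hqr hpr => by
      rw [commutatorElement_transvection hpq hqr hpr, mul_one, zpow_one]
  have hneg : ∀ {p q r : ι} (hpq : p ≠ q) (hqr : q ≠ r) (hpr : p ≠ r),
      ⁅transvection hqr (1 : ℤ), transvection hpq (1 : ℤ)⁆ = transvection hpr (1 : ℤ) ^ (-1 : ℤ) :=
    fun hpq hqr hpr => by
      rw [← commutatorElement_inv, commutatorElement_transvection hpq hqr hpr, mul_one, zpow_neg,
        zpow_one]
  have hrel : ∀ l, ⁅a l, a (l + 2)⁆ = a (l + 1) ^ s l := fun l => by
    rw [← map_commutatorElement, ← map_zpow]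
    congr 1
    fin_cases l
    · exact hpos hij hjk hik
    · exact hneg hij.symm hik hjk
    · exact hpos hjk hik.symm hij.symm
    · exact hneg hjk.symm hij.symm hik.symm
    · exact hpos hik.symm hij hjk.symm
    · exact hneg hik hjk.symm hij
  let d : Fin 6 → K := fun l => ⟨a l ^ M, hK _⟩
  have hd : ∀ l, Commute (d l) (d (l + 1)) := fun l =>
    Subtype.ext ((ha l).pow_pow M M)
  have hdrel : ∀ l, ⁅d l, d (l + 2)⁆ = d (l + 1) ^ (s l * M) := fun l => by
    have hz : ∀ l, Commute (a l) (a (l + 1) ^ s l) := fun l => (ha l).zpow_right _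
    have hz' : ∀ l, Commute (a (l + 2)) (a (l + 1) ^ s l) := fun l => by
      have := (ha (l + 1)).symm
      rw [add_assoc] at this
      exact this.zpow_right _
    have := commutatorElement_zpow_zpow (hrel l) (hz l) (hz' l) M M
    apply Subtype.ext
    simp only [d, Subgroup.coe_zpow, zpow_natCast, ← zpow_mul] at this ⊢
    refine this.trans ?_
    rw [← zpow_natCast, ← zpow_mul]
    ring_nf
  have h := hρ.map_zpow_eq_one_of_cyclic_heisenberg d hd (fun l => s l * M)
    (fun l => by fin_cases l <;> simp [s, hM]) hdrel 0
  have hpow : (((d 1 ^ (4 * (M : ℤ))) ^ c : K) : Matrix.SpecialLinearGroup ι ℤ) =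
      γ * transvection hik ((4 * M * M : ℕ) * c) * γ⁻¹ := by
    have : γ * transvection hik ((4 * M * M : ℕ) * c) * γ⁻¹ =
        MulAut.conj γ (transvection hik 1 ^ (M * (4 * M) * c : ℤ)) := by
      rw [transvection_zpow, MulAut.conj_apply]
      congr 3
      push_cast
      ring
    rw [this, map_zpow, zpow_mul (MulAut.conj γ _), zpow_mul (MulAut.conj γ _), zpow_natCast,
      Subgroup.coe_zpow, Subgroup.coe_zpow]
    rfl
  refine ⟨(d 1 ^ (4 * (M : ℤ))) ^ c, zpow_mem (MonoidHom.mem_ker.2 ?_) c, hpow⟩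
  simpa [s] using h

/-- **Corollary.** For `n ≥ 6`, any `C¹` action of a finite-index subgroup of
`SL(n,ℤ)` on the circle factors through an action of a finite group. -/
theorem c1_action_of_finite_index_subgroup_of_SLnZ_factors_through_finite
    {n : ℕ} (hn : 6 ≤ n)
    (K : Subgroup (Matrix.SpecialLinearGroup (Fin n) ℤ)) (hK : K.FiniteIndex)
    (ρ : K →* (UnitAddCircle ≃ₜ UnitAddCircle))
    (hρ : IsC1Action ρ) :
    (MonoidHom.ker ρ).FiniteIndex := by
  set N := ρ.ker.map K.subtype with hN
  set M := K.normalCore.index with hM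
  have hM0 : M ≠ 0 := Subgroup.FiniteIndex.index_ne_zero
  have hKM : ∀ x : Matrix.SpecialLinearGroup (Fin n) ℤ, x ^ M ∈ K := fun x =>
    K.normalCore_le (Subgroup.pow_index_mem _ x)
  have hcard : 2 < Fintype.card (Fin n) := by
    rw [Fintype.card_fin]
    omega
  have hcore : N.normalCore.FiniteIndex := by
    refine Matrix.SpecialLinearGroup.finiteIndex_of_forall_transvection_mem N.normalCore hcard
      (m := 4 * M * M) ?_ fun i j hij c γ => ?_
    · have := Nat.mul_pos (Nat.pos_of_ne_zero hM0) (Nat.pos_of_ne_zero hM0)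
      rw [mul_assoc]
      omega
    · obtain ⟨k, hki, hkj⟩ :=
        Matrix.SpecialLinearGroup.exists_ne_and_ne_of_two_lt_card hcard i j
      exact hρ.conj_transvection_mem_map_ker hM0 hKM hki.symm hij hkj γ c
  have hNfin : N.FiniteIndex := Subgroup.finiteIndex_of_le N.normalCore_le
  have : ρ.ker = N.subgroupOf K := by
    rw [Subgroup.subgroupOf, hN, Subgroup.comap_map_eq_self_of_injective K.subtype_injective]
  rw [this]
  infer_instance
end
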